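/- arXiv:1912.12748 — 12 statements merged into one kernel-verified Lean document; each statement's English description precedes it below -/
import Mathlib

section
/- Let S be an irreducible constraint, presented by an irreducible deterministic labeled graph G whose alphabet Σ is partitioned into nonempty sets Σ0 and Σ1, and let n0 and n1 be positive integers. Then there exists an (S,n0,n1)-encoder if and only if there exists a nonnegative nonzero integer vector x indexed by the states of G satisfying componentwise A_{G_0} x ≥ n0 x and A_{G_1} x ≥ n1 x (i.e., X(A_{G_0},A_{G_1},n0,n1) ≠ ∅). -/
open scoped Classical

/-- A finite labeled directed graph over alphabet `A`: a nonempty finite set of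
states, a finite set of edges each with an initial and terminal state, and a
labeling of edges by symbols of `A`. -/
structure LGraph (A : Type u) where
  V : Type u
  [fintypeV : Fintype V]
  [nonemptyV : Nonempty V]
  E : Type u
  [fintypeE : Fintype E]
  src : E → V
  dst : E → V
  lab : E → A

attribute [instance] LGraph.fintypeV LGraph.nonemptyV LGraph.fintypeE

namespace LGraph

variable {A : Type*}

/-- `G.IsWalk u es` : `es` is a sequence of consecutive edges starting at `u`. -/
def IsWalk (G : LGraph A) : G.V → List G.E → Prop
  | _, [] => True
  | u, e :: es => G.src e = u ∧ G.IsWalk (G.dst e) es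

/-- The terminal state of a walk. -/
def endState (G : LGraph A) : G.V → List G.E → G.V
  | u, [] => u
  | _, e :: es => G.endState (G.dst e) es

/-- The constraint `S(G)` presented by `G`: all words generated by finite paths. -/
def constraint (G : LGraph A) : Set (List A) :=
  { w | ∃ u es, G.IsWalk u es ∧ es.map G.lab = w }

/-- No state has two distinct outgoing edges with the same label. -/
def Deterministic (G : LGraph A) : Prop :=
  ∀ e e' : G.E, G.src e = G.src e' → G.lab e = G.lab e' → e = e'

/-- No two distinct paths with the same initial state and the same terminal
state generate the same word. -/
def Lossless (G : LGraph A) : Prop :=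
  ∀ (u : G.V) (es es' : List G.E), G.IsWalk u es → G.IsWalk u es' →
    G.endState u es = G.endState u es' → es.map G.lab = es'.map G.lab → es = es'

/-- Strong connectivity. -/
def Irreducible (G : LGraph A) : Prop :=
  ∀ u v : G.V, ∃ es : List G.E, G.IsWalk u es ∧ G.endState u es = v

/-- Primitivity (in the equivalent form: some power of the adjacency matrix is
entrywise positive, i.e. there is a uniform positive length `ℓ` such that any
state can be reached from any state by a walk of length `ℓ`). -/
def Primitive (G : LGraph A) : Prop :=
  ∃ ℓ : ℕ, 0 < ℓ ∧ ∀ u v : G.V, ∃ es : List G.E,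
    G.IsWalk u es ∧ es.length = ℓ ∧ G.endState u es = v

/-- The adjacency matrix of the subgraph of `G` consisting of the edges whose
labels lie in `P`: its `(u,v)` entry is the number of edges from `u` to `v`
with label in `P`. -/
noncomputable def subAdj (G : LGraph A) (P : Set A) : G.V → G.V → ℕ :=
  fun u v => Nat.card {e : G.E // G.src e = u ∧ G.dst e = v ∧ G.lab e ∈ P}

/-- Every state has exactly `n` outgoing edges with label in `P`. -/
def OutDeg (G : LGraph A) (P : Set A) (n : ℕ) : Prop :=
  ∀ u : G.V, Nat.card {e : G.E // G.src e = u ∧ G.lab e ∈ P} = n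

/-- An `(S, n0, n1)`-encoder with respect to the even/odd symbol sets `S0, S1`:
a lossless graph whose constraint is contained in `S` and in which every state
has exactly `n0` outgoing edges with even labels and exactly `n1` outgoing
edges with odd labels. -/
def IsEncoder (En : LGraph A) (S : Set (List A)) (S0 S1 : Set A) (n0 n1 : ℕ) : Prop :=
  En.Lossless ∧ En.constraint ⊆ S ∧ En.OutDeg S0 n0 ∧ En.OutDeg S1 n1

/-- `x ∈ X(A_{G_0}, A_{G_1}, n0, n1)`: a nonnegative nonzero integer vector with
`A_{G_0} x ≥ n0 x` and `A_{G_1} x ≥ n1 x` componentwise. -/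
def InX (G : LGraph A) (S0 S1 : Set A) (n0 n1 : ℕ) (x : G.V → ℕ) : Prop :=
  x ≠ 0 ∧ (∀ u, n0 * x u ≤ ∑ v, G.subAdj S0 u v * x v)
        ∧ (∀ u, n1 * x u ≤ ∑ v, G.subAdj S1 u v * x v)

/-- The graph has anticipation at most `a`: all paths from a common state that
generate the same word of length `a+1` share the same first edge. -/
def AnticipationAtMost (G : LGraph A) (a : ℕ) : Prop :=
  ∀ (u : G.V) (es es' : List G.E), G.IsWalk u es → G.IsWalk u es' →
    es.length = a + 1 → es'.length = a + 1 → es.map G.lab = es'.map G.lab →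
    es.head? = es'.head?

/-- The graph has memory at most `μ`: all paths of length `μ` generating the
same word terminate in the same state. -/
def MemoryAtMost (G : LGraph A) (μ : ℕ) : Prop :=
  ∀ (u u' : G.V) (es es' : List G.E), G.IsWalk u es → G.IsWalk u' es' →
    es.length = μ → es'.length = μ → es.map G.lab = es'.map G.lab →
    G.endState u es = G.endState u' es'

/-- `(m,a)`-definiteness: all paths generating a given word of length `m+a+1`
share the same `(m+1)`-st edge. -/
def Definite (G : LGraph A) (m a : ℕ) : Prop :=
  ∀ (u u' : G.V) (es es' : List G.E), G.IsWalk u es → G.IsWalk u' es' →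
    es.length = m + a + 1 → es'.length = m + a + 1 → es.map G.lab = es'.map G.lab →
    es[m]? = es'[m]?

end LGraph

namespace LGraph

variable {A : Type*}

theorem isWalk_append (G : LGraph A) (u : G.V) (es fs : List G.E) :
    G.IsWalk u (es ++ fs) ↔ G.IsWalk u es ∧ G.IsWalk (G.endState u es) fs := by
  induction es generalizing u with
  | nil => simp [IsWalk, endState]
  | cons e es ih => simp [IsWalk, endState, ih, and_assoc]

theorem endState_append (G : LGraph A) (u : G.V) (es fs : List G.E) :
    G.endState u (es ++ fs) = G.endState (G.endState u es) fs := by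
  induction es generalizing u with
  | nil => simp [endState]
  | cons e es ih => simp [endState, ih]

/-- In a deterministic graph a walk is determined by its initial state and its word. -/
theorem Deterministic.walk_unique {G : LGraph A} (hdet : G.Deterministic) {u : G.V}
    {es fs : List G.E} (hes : G.IsWalk u es) (hfs : G.IsWalk u fs)
    (h : es.map G.lab = fs.map G.lab) : es = fs := by
  induction es generalizing u fs with
  | nil => simpa using h.symm
  | cons e es ih =>
    cases fs with
    | nil => simp at h
    | cons f fs =>
      simp only [List.map_cons, List.cons.injEq] at h
      obtain rfl : e = f := hdet e f (hes.1.trans hfs.1.symm) h.1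
      rw [ih hes.2 hfs.2 h.2]

/-- The follower set of a state: the words generated by the walks starting there. -/
def follower (G : LGraph A) (u : G.V) : Set (List A) :=
  { w | ∃ es, G.IsWalk u es ∧ es.map G.lab = w }

/-- The states reached from `u` by the walks generating `w`. -/
def reach (G : LGraph A) (u : G.V) (w : List A) : Set G.V :=
  { v | ∃ es, G.IsWalk u es ∧ es.map G.lab = w ∧ G.endState u es = v }

theorem follower_of_append {G : LGraph A} {u : G.V} {w w' : List A}
    (h : w ++ w' ∈ G.follower u) : w ∈ G.follower u := by
  obtain ⟨es, hes, hw⟩ := h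
  obtain ⟨es₁, es₂, rfl, h₁, -⟩ := List.map_eq_append_iff.1 hw
  exact ⟨es₁, ((isWalk_append ..).1 hes).1, h₁⟩

theorem Deterministic.follower_endState {G : LGraph A} (hdet : G.Deterministic) {u : G.V}
    {es : List G.E} (hes : G.IsWalk u es) {w : List A}
    (h : es.map G.lab ++ w ∈ G.follower u) : w ∈ G.follower (G.endState u es) := by
  obtain ⟨fs, hfs, hw⟩ := h
  obtain ⟨fs₁, fs₂, rfl, h₁, h₂⟩ := List.map_eq_append_iff.1 hw
  rw [isWalk_append] at hfs
  obtain rfl := hdet.walk_unique hfs.1 hes h₁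
  exact ⟨fs₂, hfs.2, h₂⟩

theorem card_sigma_eq_sum_subAdj (G : LGraph A) (P : Set A) (x : G.V → ℕ) (u : G.V) :
    Fintype.card {p : Σ e : G.E, Fin (x (G.dst e)) // G.src p.1 = u ∧ G.lab p.1 ∈ P}
      = ∑ v, G.subAdj P u v * x v := by
  rw [← Nat.card_eq_fintype_card]
  let φ : {p : Σ e : G.E, Fin (x (G.dst e)) // G.src p.1 = u ∧ G.lab p.1 ∈ P} ≃
      Σ v : G.V, {e : G.E // G.src e = u ∧ G.dst e = v ∧ G.lab e ∈ P} × Fin (x v) :=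
    { toFun := fun p => ⟨G.dst p.1.1, ⟨p.1.1, p.2.1, rfl, p.2.2⟩, p.1.2⟩
      invFun := fun q => ⟨⟨q.2.1.1, Fin.cast (by rw [q.2.1.2.2.1]) q.2.2⟩,
        q.2.1.2.1, q.2.1.2.2.2⟩
      left_inv := fun p => rfl
      right_inv := by
        rintro ⟨v, ⟨e, h₁, rfl, h₂⟩, j⟩
        rfl }
  rw [Nat.card_congr φ, Nat.card_sigma]
  simp [subAdj]

theorem card_edges_from (G : LGraph A) {P : Set A} {n : ℕ} (h : G.OutDeg P n) (Z : Set G.V) :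
    Nat.card {e : G.E // G.src e ∈ Z ∧ G.lab e ∈ P} = n * Nat.card Z := by
  let φ : {e : G.E // G.src e ∈ Z ∧ G.lab e ∈ P} ≃
      Σ z : Z, {e : G.E // G.src e = z ∧ G.lab e ∈ P} :=
    { toFun := fun e => ⟨⟨G.src e.1, e.2.1⟩, e.1, rfl, e.2.2⟩
      invFun := fun q => ⟨q.2.1, by rw [q.2.2.1]; exact q.1.2, q.2.2.2⟩
      left_inv := fun e => rfl
      right_inv := by
        rintro ⟨⟨z, hz⟩, e, h₁, h₂⟩
        obtain rfl : G.src e = z := h₁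
        rfl }
  rw [Nat.card_congr φ, Nat.card_sigma]
  simp only [h _]
  simp [mul_comm]

/-- The largest size of a set `En.reach z w` all of whose continuations can be followed from `v`. -/
noncomputable def followWeight (En G : LGraph A) (z : En.V) (v : G.V) : ℕ :=
  sSup { k | ∃ w, (∀ w', w ++ w' ∈ En.follower z → w' ∈ G.follower v) ∧
    k = Nat.card (En.reach z w) }

theorem bddAbove_followWeight (En G : LGraph A) (z : En.V) (v : G.V) :
    BddAbove { k | ∃ w, (∀ w', w ++ w' ∈ En.follower z → w' ∈ G.follower v) ∧
      k = Nat.card (En.reach z w) } := by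
  refine ⟨Nat.card En.V, ?_⟩
  rintro _ ⟨w, -, rfl⟩
  exact Nat.card_le_card_of_injective Subtype.val Subtype.val_injective

theorem card_reach_le_followWeight {En G : LGraph A} {z : En.V} {v : G.V} {w : List A}
    (h : ∀ w', w ++ w' ∈ En.follower z → w' ∈ G.follower v) :
    Nat.card (En.reach z w) ≤ followWeight En G z v :=
  le_csSup (bddAbove_followWeight En G z v) ⟨w, h, rfl⟩

theorem mul_followWeight_le {En G : LGraph A} (hdet : G.Deterministic) (hl : En.Lossless)
    {P : Set A} {n : ℕ} (hn : En.OutDeg P n) (z : En.V) (v : G.V) :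
    n * followWeight En G z v ≤ ∑ v', G.subAdj P v v' * followWeight En G z v' := by
  rcases Set.eq_empty_or_nonempty { k | ∃ w,
    (∀ w', w ++ w' ∈ En.follower z → w' ∈ G.follower v) ∧
      k = Nat.card (En.reach z w) } with h | h
  · rw [followWeight, h]
    simp
  obtain ⟨w, hw, hk⟩ := Nat.sSup_mem h (bddAbove_followWeight En G z v)
  rw [← card_sigma_eq_sum_subAdj, followWeight, hk, ← card_edges_from En hn,
    ← Nat.card_eq_fintype_card]
  have hstep : ∀ e : {e : En.E // En.src e ∈ En.reach z w ∧ En.lab e ∈ P},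
      En.dst e.1 ∈ En.reach z (w ++ [En.lab e.1]) ∧
        ∃ f : G.E, G.src f = v ∧ G.lab f = En.lab e.1 := by
    rintro ⟨e, ⟨es, hes, hw', hend⟩, -⟩
    have hwalk : En.IsWalk z (es ++ [e]) :=
      (isWalk_append ..).2 ⟨hes, hend.symm, trivial⟩
    refine ⟨⟨es ++ [e], hwalk, by simp [hw'], by simp [endState_append, endState]⟩, ?_⟩
    obtain ⟨fs, hfs, hlab⟩ := hw [En.lab e] ⟨_, hwalk, by simp [hw']⟩
    obtain ⟨f, rfl, hf⟩ := List.map_eq_singleton_iff.1 hlab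
    exact ⟨f, hfs.1, hf⟩
  choose hreach f hsrc hlab using hstep
  have hle : ∀ g : G.E, G.src g = v →
      Nat.card (En.reach z (w ++ [G.lab g])) ≤ followWeight En G z (G.dst g) := by
    intro g hg
    refine card_reach_le_followWeight fun w' hw' => ?_
    have := hw (G.lab g :: w') (by simpa using hw')
    exact hdet.follower_endState (u := v) (es := [g]) ⟨hg, trivial⟩ (by simpa using this)
  have hemb : ∀ a : A, ∀ k, Nat.card (En.reach z (w ++ [a])) ≤ k →
      ∃ i : En.reach z (w ++ [a]) → Fin k, Function.Injective i := by
    intro a k hk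
    exact ⟨fun s => Fin.castLE hk (Finite.equivFin _ s),
      (Fin.castLE_injective hk).comp (Finite.equivFin _).injective⟩
  choose i hi using hemb
  let j (g : G.E) (hg : G.src g = v) (s : En.reach z (w ++ [G.lab g])) :
      Fin (followWeight En G z (G.dst g)) := i _ _ (hle g hg) s
  have hj : ∀ g g' hg hg' s s', (⟨g, j g hg s⟩ : Σ e : G.E, Fin (followWeight En G z (G.dst e)))
      = ⟨g', j g' hg' s'⟩ → g = g' ∧ s.1 = s'.1 := by
    intro g g' hg hg' s s' h
    obtain rfl : g = g' := congrArg Sigma.fst h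
    exact ⟨rfl, congrArg Subtype.val (hi _ _ _ (eq_of_heq (Sigma.mk.inj h).2))⟩
  refine Nat.card_le_card_of_injective
    (fun e => ⟨⟨f e, j (f e) (hsrc e) ⟨En.dst e.1, by rw [hlab e]; exact hreach e⟩⟩,
      hsrc e, by simpa only [hlab e] using e.2.2⟩) ?_
  intro e e' h
  obtain ⟨h₁, h₂⟩ := hj _ _ (hsrc e) (hsrc e') _ _ (congrArg Subtype.val h)
  obtain ⟨es, hes, hw₁, hend₁⟩ := e.2.1
  obtain ⟨es', hes', hw₂, hend₂⟩ := e'.2.1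
  have := hl z (es ++ [e.1]) (es' ++ [e'.1])
    ((isWalk_append ..).2 ⟨hes, hend₁.symm, trivial⟩)
    ((isWalk_append ..).2 ⟨hes', hend₂.symm, trivial⟩)
    (by simpa [endState_append, endState] using h₂)
    (by simp [hw₁, hw₂, ← hlab, h₁])
  exact Subtype.ext (by simpa using (List.append_inj' this rfl).2)

theorem followWeight_ne_zero {En G : LGraph A} (hdet : G.Deterministic)
    (hS : En.constraint ⊆ G.constraint) (z : En.V) : followWeight En G z ≠ 0 := by
  let R (w : List A) : Set G.V := { v | w ∈ G.follower v }
  obtain ⟨w, hw, hmin⟩ := exists_minimal_of_wellFoundedLT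
    (fun T : Set G.V => ∃ w ∈ En.follower z, R w = T) ⟨_, [], ⟨[], trivial, rfl⟩, rfl⟩
  obtain ⟨w, hwz, rfl⟩ := hw
  obtain ⟨es, hes, hlab⟩ := hwz
  obtain ⟨v, fs, hfs, hlab'⟩ := hS ⟨z, es, hes, hlab⟩
  have hle := card_reach_le_followWeight (En := En) (G := G) (z := z)
    (v := G.endState v fs) (w := w) fun w' hw' => by
      refine hdet.follower_endState hfs ?_
      rw [hlab']
      exact hmin ⟨_, hw', rfl⟩ (fun u hu => follower_of_append hu) ⟨fs, hfs, hlab'⟩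
  have hpos : 0 < Nat.card (En.reach z w) :=
    Nat.card_pos_iff.2 ⟨⟨⟨_, es, hes, hlab, rfl⟩⟩, inferInstance⟩
  intro h
  rw [h] at hle
  exact absurd hpos (Nat.not_lt.2 hle)

/-- The graph whose states are `x u` copies of each state `u` of `G`, and whose edges from a copy
of `u` are indexed by `I`: the edge `q` is a lift of the edge `(f q).1` of `G`, ending in the copy
of the terminal state given by `(f q).2`. -/
def liftGraph {A : Type u} (G : LGraph A) (x : G.V → ℕ) (I : Type) [Fintype I]
    (f : (Σ u, Fin (x u)) × I → Σ e : G.E, Fin (x (G.dst e)))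
    (hV : Nonempty (Σ u, Fin (x u))) : LGraph A where
  V := Σ u, Fin (x u)
  E := (Σ u, Fin (x u)) × I
  src q := q.1
  dst q := ⟨G.dst (f q).1, (f q).2⟩
  lab q := G.lab (f q).1

section liftGraph

variable {G : LGraph A} {x : G.V → ℕ} {I : Type} [Fintype I]
  {f : (Σ u, Fin (x u)) × I → Σ e : G.E, Fin (x (G.dst e))} {hV : Nonempty (Σ u, Fin (x u))}

theorem isWalk_of_liftGraph (hsrc : ∀ q, G.src (f q).1 = q.1.1) {p : Σ u, Fin (x u)}
    {es : List ((Σ u, Fin (x u)) × I)} (h : (G.liftGraph x I f hV).IsWalk p es) :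
    G.IsWalk p.1 (es.map fun q => (f q).1) := by
  induction es generalizing p with
  | nil => trivial
  | cons q es ih =>
    obtain ⟨rfl, h₂⟩ := h
    exact ⟨hsrc q, ih h₂⟩

theorem liftGraph_constraint_subset (hsrc : ∀ q, G.src (f q).1 = q.1.1) :
    (G.liftGraph x I f hV).constraint ⊆ G.constraint := by
  rintro _ ⟨p, es, hes, rfl⟩
  exact ⟨_, _, isWalk_of_liftGraph hsrc hes, List.map_map⟩

theorem liftGraph_walk_unique (hf : Function.Injective f) {p p' : Σ u, Fin (x u)}
    {es es' : List ((Σ u, Fin (x u)) × I)} (h : (G.liftGraph x I f hV).IsWalk p es)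
    (h' : (G.liftGraph x I f hV).IsWalk p' es')
    (hend : (G.liftGraph x I f hV).endState p es = (G.liftGraph x I f hV).endState p' es')
    (hmap : (es.map fun q => (f q).1) = es'.map fun q => (f q).1) : p = p' ∧ es = es' := by
  induction es generalizing p p' es' with
  | nil =>
    obtain rfl : es' = [] := by simpa using hmap.symm
    exact ⟨hend, rfl⟩
  | cons q es ih =>
    cases es' with
    | nil => simp at hmap
    | cons q' es' =>
      simp only [List.map_cons, List.cons.injEq] at hmap
      obtain ⟨hdst, rfl⟩ := ih h.2 h'.2 hend hmap.2
      obtain rfl : q = q' := by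
        refine hf (Sigma.ext hmap.1 ?_)
        exact (Sigma.mk.inj hdst).2
      exact ⟨h.1.symm.trans h'.1, rfl⟩

theorem liftGraph_lossless (hdet : G.Deterministic) (hf : Function.Injective f)
    (hsrc : ∀ q, G.src (f q).1 = q.1.1) : (G.liftGraph x I f hV).Lossless := by
  intro p es es' hes hes' hend hlab
  refine (liftGraph_walk_unique hf hes hes' hend ?_).2
  refine hdet.walk_unique (isWalk_of_liftGraph hsrc hes) (isWalk_of_liftGraph hsrc hes') ?_
  have hcomp : ∀ l : List ((Σ u, Fin (x u)) × I),
      (l.map fun q => (f q).1).map G.lab = l.map (G.liftGraph x I f hV).lab :=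
    fun l => List.map_map
  exact (hcomp es).trans (Eq.trans hlab (hcomp es').symm)

theorem liftGraph_outDeg {P : Set A} {Q : I → Prop} {n : ℕ} (hn : Nat.card {i // Q i} = n)
    (hQ : ∀ q, G.lab (f q).1 ∈ P ↔ Q q.2) : (G.liftGraph x I f hV).OutDeg P n := by
  intro p
  rw [← hn]
  refine Nat.card_congr
    { toFun := fun q => ⟨q.1.2, (hQ q.1).1 q.2.2⟩
      invFun := fun i => ⟨(p, i.1), rfl, (hQ (p, i.1)).2 i.2⟩
      left_inv := ?_
      right_inv := fun i => rfl }
  rintro ⟨⟨p', i⟩, rfl, h⟩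
  rfl

end liftGraph

theorem exists_edge_assignment {G : LGraph A} {P : Set A} {n : ℕ} {x : G.V → ℕ}
    (h : ∀ u, n * x u ≤ ∑ v, G.subAdj P u v * x v) :
    ∃ f : (Σ u, Fin (x u)) × Fin n → Σ e : G.E, Fin (x (G.dst e)),
      Function.Injective f ∧ ∀ q, G.src (f q).1 = q.1.1 ∧ G.lab (f q).1 ∈ P := by
  have hemb : ∀ u, Nonempty (Fin (x u) × Fin n ↪
      {p : Σ e : G.E, Fin (x (G.dst e)) // G.src p.1 = u ∧ G.lab p.1 ∈ P}) := by
    intro u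
    refine Function.Embedding.nonempty_of_card_le ?_
    rw [card_sigma_eq_sum_subAdj]
    simpa [mul_comm] using h u
  let φ := fun u => (hemb u).some
  refine ⟨fun q => (φ q.1.1 (q.1.2, q.2)).1, ?_, fun q => (φ q.1.1 (q.1.2, q.2)).2⟩
  rintro ⟨⟨u, i⟩, k⟩ ⟨⟨u', i'⟩, k'⟩ hq
  obtain rfl : u = u' := by
    have h₁ := (φ u (i, k)).2.1
    have h₂ := (φ u' (i', k')).2.1
    rw [← h₁, ← h₂]
    exact congrArg (fun s => G.src s.1) hq
  have := (φ u).injective (Subtype.ext hq)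
  simp_all

end LGraph

/-- Let `S` be an irreducible constraint, presented by an
irreducible deterministic labeled graph `G` whose alphabet is partitioned into
nonempty sets `S0` and `S1`, and let `n0, n1` be positive integers.  Then an
`(S,n0,n1)`-encoder exists iff `X(A_{G_0}, A_{G_1}, n0, n1) ≠ ∅`. -/
theorem bimodal_encoder_exists_iff {A : Type*} (G : LGraph A) (S0 S1 : Set A)
    (hS0 : S0.Nonempty) (hS1 : S1.Nonempty) (hdisj : Disjoint S0 S1)
    (hcover : S0 ∪ S1 = Set.univ)
    (hdet : G.Deterministic) (hirr : G.Irreducible)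
    (n0 n1 : ℕ) (hn0 : 0 < n0) (hn1 : 0 < n1) :
    (∃ En : LGraph A, LGraph.IsEncoder En G.constraint S0 S1 n0 n1) ↔
      ∃ x : G.V → ℕ, G.InX S0 S1 n0 n1 x := by
  constructor
  · rintro ⟨En, hl, hS, h0, h1⟩
    let z : En.V := Classical.arbitrary _
    exact ⟨LGraph.followWeight En G z, LGraph.followWeight_ne_zero hdet hS z,
      LGraph.mul_followWeight_le hdet hl h0 z, LGraph.mul_followWeight_le hdet hl h1 z⟩
  · rintro ⟨x, hx, h0, h1⟩
    obtain ⟨f0, hf0, hp0⟩ := LGraph.exists_edge_assignment h0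
    obtain ⟨f1, hf1, hp1⟩ := LGraph.exists_edge_assignment h1
    have hnot : ∀ a, a ∈ S0 → a ∉ S1 := fun _ h => Set.disjoint_left.1 hdisj h
    obtain ⟨u, hu⟩ := Function.ne_iff.1 hx
    let f : (Σ u, Fin (x u)) × (Fin n0 ⊕ Fin n1) → Σ e : G.E, Fin (x (G.dst e)) :=
      fun q => Sum.elim (fun i => f0 (q.1, i)) (fun i => f1 (q.1, i)) q.2
    have hsrc : ∀ q, G.src (f q).1 = q.1.1 := by
      rintro ⟨p, i | i⟩
      exacts [(hp0 (p, i)).1, (hp1 (p, i)).1]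
    have hlab0 : ∀ q, G.lab (f q).1 ∈ S0 ↔ q.2.isLeft = true := by
      rintro ⟨p, i | i⟩
      · exact iff_of_true (hp0 (p, i)).2 rfl
      · exact iff_of_false (fun h => hnot _ h (hp1 (p, i)).2) (by simp)
    have hlab1 : ∀ q, G.lab (f q).1 ∈ S1 ↔ q.2.isRight = true := by
      rintro ⟨p, i | i⟩
      · exact iff_of_false (hnot _ (hp0 (p, i)).2) (by simp)
      · exact iff_of_true (hp1 (p, i)).2 rfl
    have hf : Function.Injective f := by
      rintro ⟨p, i | i⟩ ⟨p', i' | i'⟩ h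
      · simpa using hf0 h
      · have h₁ := (hlab0 (p, .inl i)).2 rfl
        rw [h] at h₁
        simpa using (hlab0 _).1 h₁
      · have h₁ := (hlab1 (p, .inr i)).2 rfl
        rw [h] at h₁
        simpa using (hlab1 _).1 h₁
      · simpa using hf1 h
    refine ⟨G.liftGraph x _ f ⟨⟨u, ⟨0, Nat.pos_of_ne_zero hu⟩⟩⟩,
      LGraph.liftGraph_lossless hdet hf hsrc, LGraph.liftGraph_constraint_subset hsrc,
      LGraph.liftGraph_outDeg (Q := fun i : Fin n0 ⊕ Fin n1 => i.isLeft = true) ?_ hlab0,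
      LGraph.liftGraph_outDeg (Q := fun i : Fin n0 ⊕ Fin n1 => i.isRight = true) ?_ hlab1⟩
    · rw [Nat.card_congr Equiv.sumIsLeft, Nat.card_fin]
    · rw [Nat.card_congr Equiv.sumIsRight, Nat.card_fin]
end

section
/- Let S be an irreducible constraint, presented by an irreducible deterministic labeled graph G whose alphabet Σ is partitioned into nonempty sets Σ0 and Σ1, and let n0 and n1 be positive integers. Then for any (S,n0,n1)-encoder E having finite anticipation a, one has n^a ≥ min over x ∈ X(A_{G_0},A_{G_1},n0,n1) of ‖x‖_∞, where n = max{n0,n1} and ‖x‖_∞ denotes the maximum entry of x. -/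
open scoped Classical

namespace LGraph

variable {A : Type*}

/-- `w` is generated by a walk from `u` to `v`. -/
def Connects (G : LGraph A) (u : G.V) (w : List A) (v : G.V) : Prop :=
  ∃ es, G.IsWalk u es ∧ es.map G.lab = w ∧ G.endState u es = v

/-- `w` belongs to the follower set of `u`. -/
def Follows (G : LGraph A) (u : G.V) (w : List A) : Prop :=
  ∃ es, G.IsWalk u es ∧ es.map G.lab = w

/-- The number of walks from `u` generating a given word. -/
noncomputable def walkCount (G : LGraph A) : G.V → List A → ℕ
  | _, [] => 1
  | u, c :: w => ∑ e with G.src e = u ∧ G.lab e = c, G.walkCount (G.dst e) w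

theorem follows_iff_connects (G : LGraph A) (u : G.V) (w : List A) :
    G.Follows u w ↔ ∃ v, G.Connects u w v := by
  simp [Follows, Connects]

theorem connects_append (G : LGraph A) (u v : G.V) (w w' : List A) :
    G.Connects u (w ++ w') v ↔ ∃ t, G.Connects u w t ∧ G.Connects t w' v := by
  constructor
  · rintro ⟨es, hes, hw, hv⟩
    obtain ⟨es₁, es₂, rfl, rfl, rfl⟩ := List.map_eq_append_iff.1 hw
    rw [isWalk_append] at hes
    rw [endState_append] at hv
    exact ⟨_, ⟨es₁, hes.1, rfl, rfl⟩, es₂, hes.2, rfl, hv⟩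
  · rintro ⟨t, ⟨es, hes, rfl, rfl⟩, fs, hfs, rfl, rfl⟩
    exact ⟨es ++ fs, (G.isWalk_append ..).2 ⟨hes, hfs⟩, List.map_append, G.endState_append ..⟩

theorem follows_append (G : LGraph A) (u : G.V) (w w' : List A) :
    G.Follows u (w ++ w') ↔ ∃ t, G.Connects u w t ∧ G.Follows t w' := by
  simp only [follows_iff_connects, connects_append]
  grind

theorem follows_cons (G : LGraph A) (u : G.V) (c : A) (w : List A) :
    G.Follows u (c :: w) ↔ ∃ e, G.src e = u ∧ G.lab e = c ∧ G.Follows (G.dst e) w := by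
  constructor
  · rintro ⟨es, hes, hw⟩
    obtain ⟨e, es, rfl, rfl, rfl⟩ := List.map_eq_cons_iff.1 hw
    exact ⟨e, hes.1, rfl, es, hes.2, rfl⟩
  · rintro ⟨e, rfl, rfl, es, hes, rfl⟩
    exact ⟨e :: es, ⟨rfl, hes⟩, rfl⟩

theorem Deterministic.follows_cons_iff {G : LGraph A} (hG : G.Deterministic) (e : G.E)
    (w : List A) : G.Follows (G.src e) (G.lab e :: w) ↔ G.Follows (G.dst e) w := by
  rw [follows_cons]
  constructor
  · rintro ⟨f, hf, hl, hw⟩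
    rwa [hG f e hf hl] at hw
  · exact fun h => ⟨e, rfl, rfl, h⟩

theorem Deterministic.eq_of_isWalk {G : LGraph A} (hG : G.Deterministic) {u : G.V}
    {es fs : List G.E} (hes : G.IsWalk u es) (hfs : G.IsWalk u fs)
    (h : es.map G.lab = fs.map G.lab) : es = fs := by
  induction es generalizing u fs with
  | nil => simpa using h.symm
  | cons e es ih =>
    obtain ⟨f, fs, rfl⟩ : ∃ f fs', fs = f :: fs' := by
      cases fs <;> simp_all
    simp only [List.map_cons, List.cons.injEq] at h
    obtain rfl := hG e f (hes.1.trans hfs.1.symm) h.1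
    rw [ih hes.2 hfs.2 h.2]

theorem Deterministic.connects_unique {G : LGraph A} (hG : G.Deterministic) {u v v' : G.V}
    {w : List A} (h : G.Connects u w v) (h' : G.Connects u w v') : v = v' := by
  obtain ⟨es, hes, rfl, rfl⟩ := h
  obtain ⟨fs, hfs, hl, rfl⟩ := h'
  rw [hG.eq_of_isWalk hes hfs hl.symm]

theorem walkCount_pos_iff (G : LGraph A) (u : G.V) (w : List A) :
    0 < G.walkCount u w ↔ G.Follows u w := by
  induction w generalizing u with
  | nil => simp [walkCount, Follows, IsWalk]
  | cons c w ih =>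
    rw [walkCount, follows_cons, Nat.pos_iff_ne_zero, Ne, Finset.sum_eq_zero_iff]
    simp only [← ih, Nat.pos_iff_ne_zero, Finset.mem_filter, Finset.mem_univ, true_and]
    push Not
    simp only [and_assoc]

theorem OutDeg.card_filter {G : LGraph A} {P : Set A} {n : ℕ} (h : G.OutDeg P n) (u : G.V) :
    (Finset.univ.filter fun e => G.src e = u ∧ G.lab e ∈ P).card = n := by
  rw [← h u, Nat.card_eq_fintype_card, Fintype.card_subtype]

/-- Summing the number of walks over all one-letter extensions by letters of `L` multiplies it by
at least `n` when `L` contains all possible extensions in `P`. -/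
theorem OutDeg.mul_walkCount_le {G : LGraph A} {P : Set A} {n : ℕ} (h : G.OutDeg P n)
    (L : Finset A) (u : G.V) (w : List A)
    (hL : ∀ c ∈ P, G.Follows u (w ++ [c]) → c ∈ L) :
    n * G.walkCount u w ≤ ∑ c ∈ L, G.walkCount u (w ++ [c]) := by
  induction w generalizing u with
  | nil =>
    simp only [walkCount, List.nil_append, mul_one, Finset.sum_const, smul_eq_mul]
    rw [← h.card_filter u, ← Finset.card_biUnion]
    · refine Finset.card_le_card fun e he => ?_
      simp only [Finset.mem_filter, Finset.mem_univ, true_and, Finset.mem_biUnion] at he ⊢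
      exact ⟨_, hL _ he.2 ⟨[e], ⟨he.1, trivial⟩, rfl⟩, he.1, rfl⟩
    · intro c _ d _ hcd
      simp only [Function.onFun, Finset.disjoint_left, Finset.mem_filter]
      grind
  | cons c w ih =>
    simp only [walkCount, List.cons_append]
    rw [Finset.sum_comm, Finset.mul_sum]
    refine Finset.sum_le_sum fun e he => ih _ fun d hd hw => hL d hd ?_
    simp only [Finset.mem_filter, Finset.mem_univ, true_and] at he
    exact (G.follows_cons ..).2 ⟨e, he.1, he.2, hw⟩

theorem walkCount_le_pow_length {G : LGraph A} {n : ℕ}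
    (h : ∀ u c, (Finset.univ.filter fun e => G.src e = u ∧ G.lab e = c).card ≤ n)
    (u : G.V) (w : List A) : G.walkCount u w ≤ n ^ w.length := by
  induction w generalizing u with
  | nil => simp [walkCount]
  | cons c w ih =>
    calc G.walkCount u (c :: w) ≤ _ • n ^ w.length := Finset.sum_le_card_nsmul _ _ _ fun e _ => ih _
      _ ≤ n * n ^ w.length := Nat.mul_le_mul_right _ (h u c)
      _ = n ^ (c :: w).length := by rw [List.length_cons, pow_succ']

theorem AnticipationAtMost.eq_of_follows {G : LGraph A} {a : ℕ} (ha : G.AnticipationAtMost a)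
    {e f : G.E} (hs : G.src e = G.src f) (hl : G.lab e = G.lab f) {w : List A}
    (hw : a ≤ w.length) (he : G.Follows (G.dst e) w) (hf : G.Follows (G.dst f) w) : e = f := by
  rw [← List.take_append_drop a w, follows_append] at he hf
  obtain ⟨_, ⟨es, hes, hesw, -⟩, -⟩ := he
  obtain ⟨_, ⟨fs, hfs, hfsw, -⟩, -⟩ := hf
  have hlen := congrArg List.length hesw
  have hlen' := congrArg List.length hfsw
  rw [List.length_map, List.length_take, min_eq_left hw] at hlen hlen'
  simpa using ha (G.src e) (e :: es) (f :: fs) ⟨rfl, hes⟩ ⟨hs.symm, hfs⟩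
    (by simp [hlen]) (by simp [hlen']) (by simp [hl, hesw, hfsw])

theorem AnticipationAtMost.walkCount_le {G : LGraph A} {a n : ℕ} (ha : G.AnticipationAtMost a)
    (hn : 0 < n)
    (h : ∀ u c, (Finset.univ.filter fun e => G.src e = u ∧ G.lab e = c).card ≤ n)
    (u : G.V) (w : List A) : G.walkCount u w ≤ n ^ a := by
  induction w generalizing u with
  | nil => exact Nat.one_le_pow _ _ hn
  | cons c w ih =>
    by_cases hw : a ≤ w.length
    · by_cases hex : ∃ e, G.src e = u ∧ G.lab e = c ∧ G.Follows (G.dst e) w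
      · obtain ⟨e, he, hc, hf⟩ := hex
        rw [walkCount, Finset.sum_eq_single_of_mem e (by simp [he, hc])]
        · exact ih _
        · intro f hfm hne
          simp only [Finset.mem_filter, Finset.mem_univ, true_and] at hfm
          by_contra h0
          rw [← Ne, ← Nat.pos_iff_ne_zero, walkCount_pos_iff] at h0
          exact hne (ha.eq_of_follows (hfm.1.trans he.symm) (hfm.2.trans hc.symm) hw h0 hf)
      · rw [← follows_cons, ← walkCount_pos_iff] at hex
        omega
    · exact (walkCount_le_pow_length h u _).trans
        (Nat.pow_le_pow_right hn (by simp only [List.length_cons]; omega))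

theorem sum_subAdj_mul (G : LGraph A) (P : Set A) (u : G.V) (x : G.V → ℕ) :
    ∑ v, G.subAdj P u v * x v = ∑ e with G.src e = u ∧ G.lab e ∈ P, x (G.dst e) := by
  rw [← Finset.sum_fiberwise _ G.dst]
  refine Finset.sum_congr rfl fun v _ => ?_
  rw [Finset.sum_congr rfl (g := fun _ => x v) (by simp +contextual), Finset.sum_const,
    smul_eq_mul, subAdj, Nat.card_eq_fintype_card, Fintype.card_subtype, Finset.filter_filter]
  congr 3
  ext e
  tauto

/-- Every continuation in `H` of the word `w` read from `s` can be read in `G` from `u`. -/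
def Dominates (G H : LGraph A) (s : H.V) (w : List A) (u : G.V) : Prop :=
  ∀ w', H.Follows s (w ++ w') → G.Follows u w'

theorem Dominates.step {G H : LGraph A} (hG : G.Deterministic) {s : H.V} {w : List A} {e : G.E}
    (h : G.Dominates H s w (G.src e)) : G.Dominates H s (w ++ [G.lab e]) (G.dst e) := by
  intro w' hw'
  rw [← hG.follows_cons_iff]
  exact h _ (by simpa using hw')

/-- If all words of `H` occur in the deterministic graph `G`, then after a suitable word some state
of `G` dominates. -/
theorem Deterministic.exists_dominates {G H : LGraph A} (hG : G.Deterministic)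
    (hS : H.constraint ⊆ G.constraint) (s : H.V) :
    ∃ w u, H.Follows s w ∧ G.Dominates H s w u := by
  let U : List A → Finset G.V := fun w => {v | ∃ u, G.Connects u w v}
  obtain ⟨w, hw, hmin⟩ := (InvImage.wf (fun w => (U w).card) wellFounded_lt).has_min
    {w | H.Follows s w} ⟨[], [], trivial, rfl⟩
  obtain ⟨es, hes, hew⟩ := hw
  obtain ⟨v, fs, hfs, hfw⟩ := hS ⟨s, es, hes, hew⟩
  have hmem : G.endState v fs ∈ U w := by
    simp only [U, Finset.mem_filter, Finset.mem_univ, true_and]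
    exact ⟨v, fs, hfs, hfw, rfl⟩
  refine ⟨w, G.endState v fs, ⟨es, hes, hew⟩, fun w' hw' => ?_⟩
  by_contra hcon
  refine hmin _ hw' (lt_of_le_of_lt ?_ (Finset.card_erase_lt_of_mem hmem))
  refine Finset.card_le_card_of_forall_subsingleton (fun v' t => G.Connects t w' v') ?_ ?_
  · intro v' hv'
    simp only [U, Finset.mem_filter, Finset.mem_univ, true_and, connects_append] at hv'
    obtain ⟨u, t, hut, htv⟩ := hv'
    refine ⟨t, Finset.mem_erase.2 ⟨?_, ?_⟩, htv⟩
    · rintro rfl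
      exact hcon ((G.follows_iff_connects ..).2 ⟨_, htv⟩)
    · simpa [U] using ⟨u, hut⟩
  · rintro t - v₁ ⟨-, h₁⟩ v₂ ⟨-, h₂⟩
    exact hG.connects_unique h₁ h₂

/-- The largest number of walks from `s` generating a common word that `u` dominates. -/
noncomputable def maxCount (G H : LGraph A) (s : H.V) (u : G.V) : ℕ :=
  sSup {m | ∃ w, G.Dominates H s w u ∧ H.walkCount s w = m}

theorem mul_maxCount_le {G H : LGraph A} (hG : G.Deterministic) {P : Set A} {n N : ℕ}
    (hH : H.OutDeg P n) (s : H.V) (hN : ∀ w, H.walkCount s w ≤ N) (u : G.V) :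
    n * G.maxCount H s u ≤ ∑ v, G.subAdj P u v * G.maxCount H s v := by
  have hbdd (v : G.V) : BddAbove {m | ∃ w, G.Dominates H s w v ∧ H.walkCount s w = m} :=
    ⟨N, by rintro _ ⟨w, -, rfl⟩; exact hN w⟩
  rcases Set.eq_empty_or_nonempty {m | ∃ w, G.Dominates H s w u ∧ H.walkCount s w = m} with
    hempty | hne
  · simp [maxCount, hempty]
  obtain ⟨w, hw, hmax⟩ := Nat.sSup_mem hne (hbdd u)
  rw [sum_subAdj_mul, maxCount, ← hmax]
  refine (hH.mul_walkCount_le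
    ((Finset.univ.filter fun e => G.src e = u ∧ G.lab e ∈ P).image G.lab) s w ?_).trans ?_
  · intro c hc hf
    obtain ⟨e, he, rfl, -⟩ := (G.follows_cons ..).1 (hw [c] hf)
    exact Finset.mem_image_of_mem _ (by simp [he, hc])
  · rw [Finset.sum_image]
    · refine Finset.sum_le_sum fun e he => le_csSup (hbdd _) ⟨_, Dominates.step hG ?_, rfl⟩
      simp only [Finset.mem_filter, Finset.mem_univ, true_and] at he
      rwa [he.1]
    · intro e he f hf hl
      simp only [Finset.coe_filter, Finset.mem_univ, true_and, Set.mem_ofPred_eq] at he hf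
      exact hG e f (he.1.trans hf.1.symm) hl

end LGraph

/-- For any `(S,n0,n1)`-encoder `En` having finite
anticipation `a`, one has `n^a ≥ min_{x ∈ X(A_{G_0},A_{G_1},n0,n1)} ‖x‖_∞`,
where `n = max {n0, n1}`. -/
theorem bimodal_encoder_anticipation_lower_bound {A : Type*} (G : LGraph A) (S0 S1 : Set A)
    (hS0 : S0.Nonempty) (hS1 : S1.Nonempty) (hdisj : Disjoint S0 S1)
    (hcover : S0 ∪ S1 = Set.univ)
    (hdet : G.Deterministic) (hirr : G.Irreducible)
    (n0 n1 : ℕ) (hn0 : 0 < n0) (hn1 : 0 < n1)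
    (En : LGraph A) (hEn : LGraph.IsEncoder En G.constraint S0 S1 n0 n1)
    (a : ℕ) (ha : LGraph.AnticipationAtMost En a)
    (hamin : ∀ a' < a, ¬ LGraph.AnticipationAtMost En a') :
    sInf {m : ℕ | ∃ x : G.V → ℕ, G.InX S0 S1 n0 n1 x ∧ m = Finset.univ.sup x}
      ≤ (max n0 n1) ^ a := by
  obtain ⟨-, hS, h0, h1⟩ := hEn
  obtain ⟨s⟩ := En.nonemptyV
  have hdeg (u : En.V) (c : A) :
      (Finset.univ.filter fun e => En.src e = u ∧ En.lab e = c).card ≤ max n0 n1 := by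
    rcases (hcover ▸ Set.mem_univ c : c ∈ S0 ∪ S1) with hc | hc
    · rw [← h0.card_filter u]
      refine le_max_of_le_left (Finset.card_le_card fun e he => ?_)
      simp_all
    · rw [← h1.card_filter u]
      refine le_max_of_le_right (Finset.card_le_card fun e he => ?_)
      simp_all
  have hN : ∀ w, En.walkCount s w ≤ max n0 n1 ^ a :=
    ha.walkCount_le (lt_max_of_lt_left hn0) hdeg s
  have hx : G.InX S0 S1 n0 n1 (G.maxCount En s) := by
    refine ⟨fun hzero => ?_, LGraph.mul_maxCount_le hdet h0 s hN,
      LGraph.mul_maxCount_le hdet h1 s hN⟩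
    obtain ⟨w, u, hw, hu⟩ := hdet.exists_dominates hS s
    refine ((En.walkCount_pos_iff s w).2 hw).ne' (Nat.le_zero.1 ?_)
    refine le_of_le_of_eq ?_ (congrFun hzero u)
    exact le_csSup ⟨_, by rintro _ ⟨w, -, rfl⟩; exact hN w⟩ ⟨w, hu, rfl⟩
  refine le_trans (Nat.sInf_le (Set.mem_ofPred.2 ⟨_, hx, rfl⟩)) (Finset.sup_le fun u _ => ?_)
  exact csSup_le' (by rintro _ ⟨w, -, rfl⟩; exact hN w)
end

section
/- Let G be a deterministic labeled graph over an alphabet Σ partitioned into Σ0 and Σ1, let n0, n1 be positive integers, and let x = (x_u)_{u ∈ V(G)} be a strictly positive integer vector in X(A_{G_0},A_{G_1},n0,n1). For a state u and b ∈ {0,1}, let Σ_b(u) denote the set of symbols from Σ_b labeling edges outgoing from u, let τ(u;a) denote the terminal state of the unique edge labeled a out of u, and let Δ_b(u) = {(a,j) : a ∈ Σ_b(u), 0 ≤ j < x_{τ(u;a)}}. Suppose that for each b ∈ {0,1} and each state u, pairwise disjoint subsets Δ_b^(0)(u), ..., Δ_b^(x_u−1)(u) of Δ_b(u) are given, each of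 cardinality n_b. Define the graph E with states (u,i) for u ∈ V(G) and 0 ≤ i < x_u, with an edge (u,i) →(labeled a)→ (τ(u;a), j) for each b ∈ {0,1} and each (a,j) ∈ Δ_b^(i)(u). Then E is an (S(G),n0,n1)-encoder. -/
open scoped Classical

namespace LGraph

variable {A : Type*}

/-- The stethering graph built from `G`, a strictly positive weight vector `x`,
and the choice `Δ` of subsets `Δ_b^{(i)}(u)`:  its states are the pairs `(u,i)`
with `u` a `G`-state and `i < x u`, and for each `b ∈ {0,1}` and each
`(a, j) ∈ Δ_b^{(i)}(u)` it has an edge labeled `a` from `(u,i)` to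
`(τ(u;a), j)`, where `τ(u;a)` is the terminal state of the (unique, by
determinism) edge `e` of `G` labeled `a` going out of `u`; the edge is
recorded as the tuple `((u,i), b, (e, j))`. -/
noncomputable def stether (G : LGraph A) (x : G.V → ℕ) (hx : ∀ u, 0 < x u)
    (Δ : Bool → (u : G.V) → ℕ → Set (A × ℕ)) : LGraph A where
  V := Σ u : G.V, Fin (x u)
  fintypeV := by infer_instance
  nonemptyV := ⟨⟨Classical.arbitrary G.V, ⟨0, hx _⟩⟩⟩
  E := {q : (Σ u : G.V, Fin (x u)) × Bool × (Σ e : G.E, Fin (x (G.dst e))) //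
        G.src q.2.2.1 = q.1.1 ∧
        (G.lab q.2.2.1, (q.2.2.2 : ℕ)) ∈ Δ q.2.1 q.1.1 (q.1.2 : ℕ)}
  fintypeE := by infer_instance
  src q := q.1.1
  dst q := ⟨G.dst q.1.2.2.1, q.1.2.2.2⟩
  lab q := G.lab q.1.2.2.1

end LGraph

namespace LGraph

variable {A : Type*} {G : LGraph A} {x : G.V → ℕ} {hx : ∀ u, 0 < x u}
  {Δ : Bool → (u : G.V) → ℕ → Set (A × ℕ)}

/-- The underlying `G`-edge of an edge of the stethering graph. -/
def stetherBase (e : (G.stether x hx Δ).E) : G.E := e.1.2.2.1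

theorem IsWalk.map_stetherBase {es : List (G.stether x hx Δ).E} :
    ∀ {u : (G.stether x hx Δ).V}, (G.stether x hx Δ).IsWalk u es →
      G.IsWalk u.1 (es.map stetherBase) := by
  induction es with
  | nil => intro u _; trivial
  | cons e es ih =>
    rintro u ⟨rfl, h⟩
    exact ⟨e.2.1, ih h⟩

theorem stether_constraint_subset : (G.stether x hx Δ).constraint ⊆ G.constraint := by
  rintro w ⟨u, es, h, rfl⟩
  exact ⟨u.1, es.map stetherBase, h.map_stetherBase, by rw [List.map_map]; rfl⟩

/-- In the stethering graph of a deterministic graph, two walks whose initial states lie over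
the same state of `G`, which generate the same word and have the same terminal state, agree. -/
theorem stether_walk_unique (hdet : G.Deterministic)
    (hΔ : ∀ b b' u i i', i < x u → i' < x u → ∀ p, p ∈ Δ b u i → p ∈ Δ b' u i' →
      b = b' ∧ i = i') {es : List (G.stether x hx Δ).E} :
    ∀ {es' : List (G.stether x hx Δ).E} {u u' : (G.stether x hx Δ).V}, u.1 = u'.1 →
      (G.stether x hx Δ).IsWalk u es → (G.stether x hx Δ).IsWalk u' es' →
      (G.stether x hx Δ).endState u es = (G.stether x hx Δ).endState u' es' →
      es.map (G.stether x hx Δ).lab = es'.map (G.stether x hx Δ).lab →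
      u = u' ∧ es = es' := by
  induction es with
  | nil =>
    intro es' u u' _ _ _ hend hlab
    obtain rfl : es' = [] := by simpa using hlab.symm
    exact ⟨hend, rfl⟩
  | cons e es ih =>
    intro es' u u' huu h h' hend hlab
    cases es' with
    | nil => simp at hlab
    | cons e' es' =>
      obtain ⟨rfl, h⟩ := h
      obtain ⟨rfl, h'⟩ := h'
      rw [List.map_cons, List.map_cons, List.cons.injEq] at hlab
      have hbase : stetherBase e = stetherBase e' :=
        hdet _ _ (e.2.1.trans (huu.trans e'.2.1.symm)) hlab.1
      obtain ⟨hdst, rfl⟩ := ih (congrArg G.dst hbase) h h' hend hlab.2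
      obtain ⟨⟨⟨u, i⟩, b, f, j⟩, hs, hm⟩ := e
      obtain ⟨⟨⟨u', i'⟩, b', f', j'⟩, hs', hm'⟩ := e'
      obtain rfl : u = u' := huu
      obtain rfl : f = f' := hbase
      obtain rfl : j = j' := eq_of_heq (Sigma.mk.inj hdst).2
      obtain ⟨rfl, hi⟩ := hΔ b b' u i i' i.2 i'.2 _ hm hm'
      obtain rfl : i = i' := Fin.ext hi
      exact ⟨rfl, rfl⟩

theorem stether_outDeg (hdet : G.Deterministic) {P : Set A} {b : Bool} {n : ℕ}
    (hΔ : ∀ b' u i, i < x u → ∀ p ∈ Δ b' u i, p.1 ∈ P ↔ b' = b)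
    (hΔedge : ∀ u i, i < x u → ∀ p ∈ Δ b u i, ∃ e : G.E,
      G.src e = u ∧ G.lab e = p.1 ∧ p.2 < x (G.dst e))
    (hΔcard : ∀ u i, i < x u → (Δ b u i).ncard = n) :
    (G.stether x hx Δ).OutDeg P n := by
  rintro ⟨u, i⟩
  rw [← hΔcard u i i.2, ← Nat.card_coe_set_eq]
  have hmem (e : {e : (G.stether x hx Δ).E //
      (G.stether x hx Δ).src e = ⟨u, i⟩ ∧ (G.stether x hx Δ).lab e ∈ P}) :
      (G.lab e.1.1.2.2.1, (e.1.1.2.2.2 : ℕ)) ∈ Δ b u i := by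
    obtain ⟨⟨⟨⟨u', i'⟩, b', f, j⟩, hs, hm⟩, hsrc, hlab⟩ := e
    cases hsrc
    obtain rfl := (hΔ b' u i i.2 _ hm).1 hlab
    exact hm
  refine Nat.card_eq_of_bijective (fun e => ⟨_, hmem e⟩) ⟨?_, ?_⟩
  · rintro ⟨⟨⟨⟨u₁, i₁⟩, b₁, f₁, j₁⟩, hs₁, hm₁⟩, hsrc₁, hlab₁⟩
      ⟨⟨⟨⟨u₂, i₂⟩, b₂, f₂, j₂⟩, hs₂, hm₂⟩, hsrc₂, hlab₂⟩ heq
    cases hsrc₁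
    cases hsrc₂
    obtain ⟨hl, hj⟩ := Prod.mk.inj (Subtype.mk.inj heq)
    obtain rfl : f₁ = f₂ := hdet _ _ (hs₁.trans hs₂.symm) hl
    obtain rfl : j₁ = j₂ := Fin.ext hj
    obtain rfl := (hΔ b₁ u i i.2 _ hm₁).1 hlab₁
    obtain rfl := (hΔ b₂ u i i.2 _ hm₂).1 hlab₂
    rfl
  · rintro ⟨⟨a, j⟩, hp⟩
    obtain ⟨f, hs, rfl, hj⟩ := hΔedge u i i.2 _ hp
    exact ⟨⟨⟨⟨⟨u, i⟩, b, f, ⟨j, hj⟩⟩, hs, hp⟩, rfl, (hΔ b u i i.2 _ hp).2 rfl⟩, rfl⟩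

end LGraph

/-- Let `G` be a deterministic labeled graph over an alphabet
partitioned into `S0` and `S1`, let `n0, n1` be positive integers, and let `x`
be a strictly positive vector in `X(A_{G_0},A_{G_1},n0,n1)`.  Suppose for each
`b` and each state `u` we are given pairwise disjoint subsets
`Δ_b^{(0)}(u), …, Δ_b^{(x_u - 1)}(u)` of
`Δ_b(u) = {(a,j) : a ∈ Σ_b(u), j < x_{τ(u;a)}}`, each of cardinality `n_b`.
Then the graph `E` with states `(u,i)` (`i < x_u`) and an edge
`(u,i) —a→ (τ(u;a), j)` for each `b` and each `(a,j) ∈ Δ_b^{(i)}(u)` is an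
`(S(G), n0, n1)`-encoder. -/
theorem stether_isEncoder {A : Type*} (G : LGraph A) (S0 S1 : Set A)
    (hdisj : Disjoint S0 S1) (hcover : S0 ∪ S1 = Set.univ)
    (hdet : G.Deterministic)
    (n0 n1 : ℕ) (hn0 : 0 < n0) (hn1 : 0 < n1)
    (x : G.V → ℕ) (hx : ∀ u, 0 < x u) (hX : G.InX S0 S1 n0 n1 x)
    (Δ : Bool → (u : G.V) → ℕ → Set (A × ℕ))
    (hΔsub : ∀ b u i, i < x u → ∀ p ∈ Δ b u i, ∃ e : G.E,
      G.src e = u ∧ G.lab e = p.1 ∧ G.lab e ∈ (bif b then S1 else S0) ∧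
        p.2 < x (G.dst e))
    (hΔdisj : ∀ b u i i', i < x u → i' < x u → i ≠ i' →
      Disjoint (Δ b u i) (Δ b u i'))
    (hΔcard : ∀ b u i, i < x u → (Δ b u i).ncard = (bif b then n1 else n0)) :
    LGraph.IsEncoder (G.stether x hx Δ) G.constraint S0 S1 n0 n1 := by
  have hS (a : A) (h0 : a ∈ S0) (h1 : a ∈ S1) : False := Set.disjoint_left.1 hdisj h0 h1
  have hlab : ∀ b u i, i < x u → ∀ p ∈ Δ b u i, p.1 ∈ (bif b then S1 else S0) := by
    intro b u i hi p hp
    obtain ⟨e, -, he, hmem, -⟩ := hΔsub b u i hi p hp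
    exact he ▸ hmem
  have hedge : ∀ b u i, i < x u → ∀ p ∈ Δ b u i, ∃ e : G.E,
      G.src e = u ∧ G.lab e = p.1 ∧ p.2 < x (G.dst e) := by
    intro b u i hi p hp
    obtain ⟨e, hs, he, -, hj⟩ := hΔsub b u i hi p hp
    exact ⟨e, hs, he, hj⟩
  have hiff : ∀ b b' u i, i < x u → ∀ p ∈ Δ b' u i,
      p.1 ∈ (bif b then S1 else S0) ↔ b' = b := by
    intro b b' u i hi p hp
    have h := hlab b' u i hi p hp
    refine ⟨fun h' => ?_, fun hb => hb ▸ h⟩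
    cases b <;> cases b'
    · rfl
    · exact (hS _ h' h).elim
    · exact (hS _ h h').elim
    · rfl
  refine ⟨?_, LGraph.stether_constraint_subset,
    LGraph.stether_outDeg hdet (hiff false) (hedge false) (hΔcard false),
    LGraph.stether_outDeg hdet (hiff true) (hedge true) (hΔcard true)⟩
  intro u es es' h h' hend hw
  refine (LGraph.stether_walk_unique hdet ?_ rfl h h' hend hw).2
  intro b b' u i i' hi hi' p hp hp'
  obtain rfl := (hiff b' b u i hi p hp).1 (hlab b' u i' hi' p hp')
  refine ⟨rfl, ?_⟩
  by_contra hne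
  exact Set.disjoint_left.1 (hΔdisj b u i i' hi hi' hne) hp hp'
end

section
/- Let G be a deterministic labeled graph over an alphabet Σ partitioned into Σ0 and Σ1, and let n0, n1 be positive integers with X(A_{G_0},A_{G_1},n0,n1) ≠ ∅. Then there exists an (S(G),n0,n1)-encoder E with |V(E)| ≤ min over x ∈ X(A_{G_0},A_{G_1},n0,n1) of ‖x‖_1, where ‖x‖_1 denotes the sum of the entries of x. -/
open scoped Classical

namespace LGraph

variable {A : Type*}

/-- The edges of `G` from `u` with label in `P`, each paired with one of `x v` copies of its
terminal state `v`. -/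
abbrev CopyEdge (G : LGraph A) (x : G.V → ℕ) (P : Set A) (u : G.V) :=
  Σ v : G.V, {e : G.E // G.src e = u ∧ G.dst e = v ∧ G.lab e ∈ P} × Fin (x v)

theorem nonempty_embedding_copyEdge {G : LGraph A} {x : G.V → ℕ} {P : Set A} {n : ℕ} {u : G.V}
    (h : n * x u ≤ ∑ v, G.subAdj P u v * x v) :
    Nonempty (Fin (x u) × Fin n ↪ G.CopyEdge x P u) := by
  rw [Function.Embedding.nonempty_iff_card_le]
  simpa [subAdj, Nat.card_eq_fintype_card, mul_comm n] using h

/-- The graph whose states are `x u` copies of each state `u` of `G`, where each copy of `u`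
receives `n0` and `n1` edges as prescribed by the embeddings `f0` and `f1`. -/
noncomputable def copyGraph (G : LGraph A) {x : G.V → ℕ} {n0 n1 : ℕ} {S0 S1 : Set A}
    (f0 : ∀ u, Fin (x u) × Fin n0 ↪ G.CopyEdge x S0 u)
    (f1 : ∀ u, Fin (x u) × Fin n1 ↪ G.CopyEdge x S1 u) (hx : x ≠ 0) : LGraph A where
  V := Σ u : G.V, Fin (x u)
  nonemptyV := by
    obtain ⟨u, hu⟩ := Function.ne_iff.mp hx
    exact ⟨⟨u, ⟨0, Nat.pos_of_ne_zero hu⟩⟩⟩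
  E := (Σ u : G.V, Fin (x u)) × (Fin n0 ⊕ Fin n1)
  src p := p.1
  dst
    | (s, .inl k) => ⟨(f0 s.1 (s.2, k)).1, (f0 s.1 (s.2, k)).2.2⟩
    | (s, .inr k) => ⟨(f1 s.1 (s.2, k)).1, (f1 s.1 (s.2, k)).2.2⟩
  lab
    | (s, .inl k) => G.lab (f0 s.1 (s.2, k)).2.1
    | (s, .inr k) => G.lab (f1 s.1 (s.2, k)).2.1

/-- A label-preserving graph homomorphism. -/
structure Hom (H G : LGraph A) where
  onV : H.V → G.V
  onE : H.E → G.E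
  src_onE : ∀ e, G.src (onE e) = onV (H.src e)
  dst_onE : ∀ e, G.dst (onE e) = onV (H.dst e)
  lab_onE : ∀ e, G.lab (onE e) = H.lab e

namespace Hom

variable {H G : LGraph A}

theorem isWalk_map (π : Hom H G) (u : H.V) (es : List H.E) (h : H.IsWalk u es) :
    G.IsWalk (π.onV u) (es.map π.onE) := by
  induction es generalizing u with
  | nil => trivial
  | cons e es ih =>
    obtain ⟨rfl, h⟩ := h
    refine ⟨π.src_onE e, ?_⟩
    rw [π.dst_onE]
    exact ih _ h

theorem constraint_subset (π : Hom H G) : H.constraint ⊆ G.constraint := by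
  rintro _ ⟨u, es, h, rfl⟩
  refine ⟨_, _, π.isWalk_map u es h, ?_⟩
  simp [Function.comp_def, π.lab_onE]

theorem walk_unique (π : Hom H G) (hdet : G.Deterministic)
    (hinj : ∀ e e', π.onE e = π.onE e' → H.dst e = H.dst e' → e = e')
    (u u' : H.V) (hu : π.onV u = π.onV u') (es es' : List H.E)
    (h : H.IsWalk u es) (h' : H.IsWalk u' es') (hend : H.endState u es = H.endState u' es')
    (hlab : es.map H.lab = es'.map H.lab) : u = u' ∧ es = es' := by
  induction es generalizing u u' es' with
  | nil =>
    obtain rfl : es' = [] := by simpa using hlab.symm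
    exact ⟨hend, rfl⟩
  | cons e es ih =>
    cases es' with
    | nil => simp at hlab
    | cons e' es' =>
      obtain ⟨rfl, h⟩ := h
      obtain ⟨rfl, h'⟩ := h'
      simp only [List.map_cons, List.cons.injEq] at hlab
      have he : π.onE e = π.onE e' := hdet _ _ (by rw [π.src_onE, π.src_onE, hu])
        (by rw [π.lab_onE, π.lab_onE, hlab.1])
      obtain ⟨hd, rfl⟩ := ih (H.dst e) (H.dst e') (by rw [← π.dst_onE, ← π.dst_onE, he])
        es' h h' hend hlab.2
      obtain rfl := hinj e e' he hd
      exact ⟨rfl, rfl⟩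

theorem lossless (π : Hom H G) (hdet : G.Deterministic)
    (hinj : ∀ e e', π.onE e = π.onE e' → H.dst e = H.dst e' → e = e') : H.Lossless :=
  fun u es es' h h' hend hlab =>
    (π.walk_unique hdet hinj u u rfl es es' h h' hend hlab).2

end Hom

section copyGraph

variable {G : LGraph A} {x : G.V → ℕ} {n0 n1 : ℕ} {S0 S1 : Set A}
  (f0 : ∀ u, Fin (x u) × Fin n0 ↪ G.CopyEdge x S0 u)
  (f1 : ∀ u, Fin (x u) × Fin n1 ↪ G.CopyEdge x S1 u) (hx : x ≠ 0)

/-- The projection of the graph of copies to `G`. -/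
noncomputable def copyGraphHom : Hom (G.copyGraph f0 f1 hx) G where
  onV s := s.1
  onE
    | (s, .inl k) => (f0 s.1 (s.2, k)).2.1
    | (s, .inr k) => (f1 s.1 (s.2, k)).2.1
  src_onE := by
    rintro ⟨s, k | k⟩
    · exact (f0 s.1 (s.2, k)).2.1.2.1
    · exact (f1 s.1 (s.2, k)).2.1.2.1
  dst_onE := by
    rintro ⟨s, k | k⟩
    · exact (f0 s.1 (s.2, k)).2.1.2.2.1
    · exact (f1 s.1 (s.2, k)).2.1.2.2.1
  lab_onE := by
    rintro ⟨s, k | k⟩ <;> rfl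

theorem copyGraph_lab_inl (s : Σ u : G.V, Fin (x u)) (k : Fin n0) :
    (G.copyGraph f0 f1 hx).lab (s, .inl k) ∈ S0 :=
  (f0 s.1 (s.2, k)).2.1.2.2.2

theorem copyGraph_lab_inr (s : Σ u : G.V, Fin (x u)) (k : Fin n1) :
    (G.copyGraph f0 f1 hx).lab (s, .inr k) ∈ S1 :=
  (f1 s.1 (s.2, k)).2.1.2.2.2

theorem CopyEdge.eq_of_edge_eq {P : Set A} {u : G.V} {a b : G.CopyEdge x P u}
    (he : (a.2.1 : G.E) = b.2.1)
    (hd : (⟨a.1, a.2.2⟩ : Σ v : G.V, Fin (x v)) = ⟨b.1, b.2.2⟩) : a = b := by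
  obtain ⟨v, ⟨e, he1⟩, j⟩ := a
  obtain ⟨w, ⟨e', he2⟩, j'⟩ := b
  cases hd
  cases he
  rfl

theorem copyGraphHom_injective (hdisj : Disjoint S0 S1) (p q : (G.copyGraph f0 f1 hx).E)
    (he : (copyGraphHom f0 f1 hx).onE p = (copyGraphHom f0 f1 hx).onE q)
    (hd : (G.copyGraph f0 f1 hx).dst p = (G.copyGraph f0 f1 hx).dst q) : p = q := by
  have hsrc : p.1.1 = q.1.1 := by
    have := congrArg G.src he
    rwa [(copyGraphHom f0 f1 hx).src_onE, (copyGraphHom f0 f1 hx).src_onE] at this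
  have hlab : (G.copyGraph f0 f1 hx).lab p = (G.copyGraph f0 f1 hx).lab q := by
    rw [← (copyGraphHom f0 f1 hx).lab_onE, ← (copyGraphHom f0 f1 hx).lab_onE, he]
  obtain ⟨⟨u, i⟩, k | k⟩ := p <;> obtain ⟨⟨v, j⟩, l | l⟩ := q
  · obtain rfl : u = v := hsrc
    have h := (f0 u).injective (CopyEdge.eq_of_edge_eq he hd)
    cases h
    rfl
  · exact (hdisj.ne_of_mem (copyGraph_lab_inl f0 f1 hx _ _)
      (copyGraph_lab_inr f0 f1 hx _ _) hlab).elim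
  · exact (hdisj.ne_of_mem (copyGraph_lab_inl f0 f1 hx _ _)
      (copyGraph_lab_inr f0 f1 hx _ _) hlab.symm).elim
  · obtain rfl : u = v := hsrc
    have h := (f1 u).injective (CopyEdge.eq_of_edge_eq he hd)
    cases h
    rfl

theorem copyGraph_outDeg_left (hdisj : Disjoint S0 S1) :
    (G.copyGraph f0 f1 hx).OutDeg S0 n0 := by
  intro s
  refine (Nat.card_congr (Equiv.ofBijective
    (fun k => ⟨(s, .inl k), rfl, copyGraph_lab_inl f0 f1 hx s k⟩) ⟨?_, ?_⟩)).symm.trans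
    (Nat.card_fin n0)
  · intro k l h
    exact Sum.inl_injective (congrArg (fun p => p.1.2) h)
  · rintro ⟨⟨t, k | k⟩, rfl, h⟩
    · exact ⟨k, rfl⟩
    · exact (hdisj.notMem_of_mem_left h (copyGraph_lab_inr f0 f1 hx t k)).elim

theorem copyGraph_outDeg_right (hdisj : Disjoint S0 S1) :
    (G.copyGraph f0 f1 hx).OutDeg S1 n1 := by
  intro s
  refine (Nat.card_congr (Equiv.ofBijective
    (fun k => ⟨(s, .inr k), rfl, copyGraph_lab_inr f0 f1 hx s k⟩) ⟨?_, ?_⟩)).symm.trans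
    (Nat.card_fin n1)
  · intro k l h
    exact Sum.inr_injective (congrArg (fun p => p.1.2) h)
  · rintro ⟨⟨t, k | k⟩, rfl, h⟩
    · exact (hdisj.notMem_of_mem_left (copyGraph_lab_inl f0 f1 hx t k) h).elim
    · exact ⟨k, rfl⟩

theorem copyGraph_isEncoder (hdisj : Disjoint S0 S1) (hdet : G.Deterministic) :
    (G.copyGraph f0 f1 hx).IsEncoder G.constraint S0 S1 n0 n1 :=
  ⟨(copyGraphHom f0 f1 hx).lossless hdet (copyGraphHom_injective f0 f1 hx hdisj),
    (copyGraphHom f0 f1 hx).constraint_subset,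
    copyGraph_outDeg_left f0 f1 hx hdisj, copyGraph_outDeg_right f0 f1 hx hdisj⟩

theorem card_copyGraph : Nat.card (G.copyGraph f0 f1 hx).V = ∑ u, x u := by
  change Nat.card (Σ u : G.V, Fin (x u)) = _
  simp

end copyGraph

end LGraph

/-- If `X(A_{G_0},A_{G_1},n0,n1) ≠ ∅` for a deterministic
labeled graph `G`, then there is an `(S(G),n0,n1)`-encoder `En` with
`|V(En)| ≤ min_{x ∈ X(A_{G_0},A_{G_1},n0,n1)} ‖x‖₁`. -/
theorem bimodal_encoder_exists_with_few_states {A : Type*} (G : LGraph A) (S0 S1 : Set A)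
    (hdisj : Disjoint S0 S1) (hcover : S0 ∪ S1 = Set.univ)
    (hdet : G.Deterministic)
    (n0 n1 : ℕ) (hn0 : 0 < n0) (hn1 : 0 < n1)
    (hne : ∃ x : G.V → ℕ, G.InX S0 S1 n0 n1 x) :
    ∃ En : LGraph A, LGraph.IsEncoder En G.constraint S0 S1 n0 n1 ∧
      Nat.card En.V ≤
        sInf {m : ℕ | ∃ x : G.V → ℕ, G.InX S0 S1 n0 n1 x ∧ m = ∑ u, x u} := by
  obtain ⟨x, ⟨hx, h0, h1⟩, hmin⟩ :=
    Nat.sInf_mem (s := {m : ℕ | ∃ x : G.V → ℕ, G.InX S0 S1 n0 n1 x ∧ m = ∑ u, x u})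
      (hne.imp' (fun x => ∑ u, x u) fun x hx => ⟨x, hx, rfl⟩)
  have f0 := fun u => (LGraph.nonempty_embedding_copyEdge (h0 u)).some
  have f1 := fun u => (LGraph.nonempty_embedding_copyEdge (h1 u)).some
  exact ⟨G.copyGraph f0 f1 hx, LGraph.copyGraph_isEncoder f0 f1 hx hdisj hdet,
    (LGraph.card_copyGraph f0 f1 hx).trans_le hmin.ge⟩
end

section
/- Let A0 and A1 be k × k nonnegative integer matrices, n0, n1 positive integers, and ξ a nonnegative integer k-vector. Define the map F on nonnegative integer k-vectors by F(y)_u = min{ ⌊(A0 y)_u / n0⌋, ⌊(A1 y)_u / n1⌋, y_u } for each coordinate u. Then the sequence ξ, F(ξ), F²(ξ), ... is componentwise non-increasing and hence eventually constant, with limit x*; every vector y ∈ X(A0,A1,n0,n1) satisfying y ≤ ξ componentwise also satisfies y ≤ x* componentwise; and if x* ≠ 0 then x* ∈ X(A0,A1,n0,n1). In particular, the modified Franaszek algorithm returns the componentwise largest vector in X(A0,A1,n0,n1) that is ≤ ξ if one exists, and the all-zero vector otherwise. -/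
/-- Membership in `X(A0, A1, n0, n1)`: a nonnegative nonzero integer vector `y`
with `A0 y ≥ n0 y` and `A1 y ≥ n1 y` componentwise. -/
def InXMat {k : ℕ} (A0 A1 : Fin k → Fin k → ℕ) (n0 n1 : ℕ) (y : Fin k → ℕ) : Prop :=
  y ≠ 0 ∧ (∀ u, n0 * y u ≤ ∑ v, A0 u v * y v) ∧ (∀ u, n1 * y u ≤ ∑ v, A1 u v * y v)

section ModifiedFranaszek

variable {k : ℕ} {A0 A1 : Fin k → Fin k → ℕ} {n0 n1 : ℕ} {F : (Fin k → ℕ) → (Fin k → ℕ)}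

/-- A vector satisfying both approximate eigenvector inequalities and lying below `x`
also lies below `F x`. -/
theorem le_franaszek_step (hn0 : 0 < n0) (hn1 : 0 < n1)
    (hF : ∀ y u, F y u =
      min (min ((∑ v, A0 u v * y v) / n0) ((∑ v, A1 u v * y v) / n1)) (y u))
    {x y : Fin k → ℕ} (hy : InXMat A0 A1 n0 n1 y) (hyx : y ≤ x) : y ≤ F x := by
  have mono (A : Fin k → Fin k → ℕ) (u : Fin k) : ∑ v, A u v * y v ≤ ∑ v, A u v * x v :=
    Finset.sum_le_sum fun v _ => Nat.mul_le_mul_left _ (hyx v)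
  intro u
  rw [hF]
  refine le_min (le_min ?_ ?_) (hyx u)
  · rw [Nat.le_div_iff_mul_le hn0, mul_comm]
    exact (hy.2.1 u).trans (mono A0 u)
  · rw [Nat.le_div_iff_mul_le hn1, mul_comm]
    exact (hy.2.2 u).trans (mono A1 u)

/-- A nonzero fixed point of `F` belongs to `X(A0, A1, n0, n1)`. -/
theorem inXMat_of_franaszek_step_eq (hn0 : 0 < n0) (hn1 : 0 < n1)
    (hF : ∀ y u, F y u =
      min (min ((∑ v, A0 u v * y v) / n0) ((∑ v, A1 u v * y v) / n1)) (y u))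
    {x : Fin k → ℕ} (hx : F x = x) (hx0 : x ≠ 0) : InXMat A0 A1 n0 n1 x := by
  have key (u : Fin k) :
      x u ≤ min ((∑ v, A0 u v * x v) / n0) ((∑ v, A1 u v * x v) / n1) :=
    min_eq_right_iff.mp ((hF x u).symm.trans (congrFun hx u))
  refine ⟨hx0, fun u => ?_, fun u => ?_⟩
  · rw [mul_comm, ← Nat.le_div_iff_mul_le hn0]
    exact (key u).trans (min_le_left _ _)
  · rw [mul_comm, ← Nat.le_div_iff_mul_le hn1]
    exact (key u).trans (min_le_right _ _)

end ModifiedFranaszek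

/-- **modified Franaszek algorithm.**  With
`F(y)_u = min {⌊(A0 y)_u / n0⌋, ⌊(A1 y)_u / n1⌋, y_u}`, the iterates
`ξ, F ξ, F² ξ, …` are componentwise non-increasing, hence eventually constant
with limit `x*`; every `y ∈ X(A0,A1,n0,n1)` with `y ≤ ξ` satisfies `y ≤ x*`;
and if `x* ≠ 0` then `x* ∈ X(A0,A1,n0,n1)`.  In particular the algorithm
returns the componentwise largest vector of `X(A0,A1,n0,n1)` below `ξ` if one
exists, and the all-zero vector otherwise. -/
theorem modified_franaszek_algorithm {k : ℕ}
    (A0 A1 : Fin k → Fin k → ℕ) (n0 n1 : ℕ) (hn0 : 0 < n0) (hn1 : 0 < n1)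
    (ξ : Fin k → ℕ) (F : (Fin k → ℕ) → (Fin k → ℕ))
    (hF : ∀ y u, F y u =
      min (min ((∑ v, A0 u v * y v) / n0) ((∑ v, A1 u v * y v) / n1)) (y u)) :
    (∀ m u, F^[m + 1] ξ u ≤ F^[m] ξ u) ∧
    ∃ xstar : Fin k → ℕ,
      (∃ N, ∀ m, N ≤ m → F^[m] ξ = xstar) ∧
      (∀ y, InXMat A0 A1 n0 n1 y → y ≤ ξ → y ≤ xstar) ∧
      (xstar ≠ 0 → InXMat A0 A1 n0 n1 xstar) ∧
      ((∃ y, InXMat A0 A1 n0 n1 y ∧ y ≤ ξ) →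
        (InXMat A0 A1 n0 n1 xstar ∧ xstar ≤ ξ ∧
          ∀ y, InXMat A0 A1 n0 n1 y → y ≤ ξ → y ≤ xstar)) ∧
      ((¬ ∃ y, InXMat A0 A1 n0 n1 y ∧ y ≤ ξ) → xstar = 0) := by
  have step_le (x : Fin k → ℕ) : F x ≤ x := fun u => (hF x u).trans_le (min_le_right _ _)
  have anti : Antitone fun m => F^[m] ξ := antitone_nat_of_succ_le fun m => by
    rw [Function.iterate_succ_apply']
    exact step_le _
  obtain ⟨N, hN⟩ := wellFoundedGT_iff_monotone_chain_condition.mp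
    (inferInstance : WellFoundedGT (Fin k → ℕ)ᵒᵈ) ⟨fun m => OrderDual.toDual (F^[m] ξ), anti⟩
  have hconst : ∀ m, N ≤ m → F^[m] ξ = F^[N] ξ := fun m hm => (hN m hm).symm
  have hfix : F (F^[N] ξ) = F^[N] ξ := by
    rw [← Function.iterate_succ_apply' F N ξ]
    exact hconst _ N.le_succ
  have hle : F^[N] ξ ≤ ξ := anti N.zero_le
  have hmax : ∀ y, InXMat A0 A1 n0 n1 y → y ≤ ξ → y ≤ F^[N] ξ := fun y hy hyξ =>
    Function.Iterate.rec (fun x => y ≤ x) hyξ (fun _ => le_franaszek_step hn0 hn1 hF hy) N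
  have hmem : F^[N] ξ ≠ 0 → InXMat A0 A1 n0 n1 (F^[N] ξ) :=
    inXMat_of_franaszek_step_eq hn0 hn1 hF hfix
  refine ⟨fun m => anti m.le_succ, F^[N] ξ, ⟨N, hconst⟩, hmax, hmem, ?_, ?_⟩
  · rintro ⟨y, hy, hyξ⟩
    refine ⟨hmem fun h0 => hy.1 ?_, hle, hmax⟩
    exact le_antisymm (h0 ▸ hmax y hy hyξ) zero_le
  · intro hnone
    by_contra h0
    exact hnone ⟨_, hmem h0, hle⟩
end

section
/- Let A0 = [[1,1],[0,0]] and A1 = [[0,1],[1,0]] as 2×2 integer matrices, and define for t ≥ 1 the matrices B_t, C_t by B_1 = A0, C_1 = A1, B_t = A0·B_{t−1} + A1·C_{t−1}, and C_t = A0·C_{t−1} + A1·B_{t−1}. Then for every t ≥ 1: 6·B_t = [[2^{t+1} + 3 + (−1)^t, 2^{t+1} − 2·(−1)^t], [2^t − 3 − (−1)^t, 2^t + 2·(−1)^t]] and 6·C_t = [[2^{t+1} − 3 + (−1)^t, 2^{t+1} − 2·(−1)^t], [2^t + 3 − (−1)^t, 2^t + 2·(−1)^t]]. -/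
open Matrix

/-- Closed form for the even/odd adjacency matrices of the
powers of the two-state graph of Example 4, with partition `Σ0 = {a,b}`,
`Σ1 = {c,d}`. -/
theorem power_parity_matrices_closed_form
    (A0 A1 : Matrix (Fin 2) (Fin 2) ℤ)
    (hA0 : A0 = !![1, 1; 0, 0]) (hA1 : A1 = !![0, 1; 1, 0])
    (B C : ℕ → Matrix (Fin 2) (Fin 2) ℤ)
    (hB1 : B 1 = A0) (hC1 : C 1 = A1)
    (hB : ∀ t, 1 ≤ t → B (t + 1) = A0 * B t + A1 * C t)
    (hC : ∀ t, 1 ≤ t → C (t + 1) = A0 * C t + A1 * B t) :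
    ∀ t, 1 ≤ t →
      (6 : ℤ) • B t =
        !![2 ^ (t + 1) + 3 + (-1) ^ t, 2 ^ (t + 1) - 2 * (-1) ^ t;
           2 ^ t - 3 - (-1) ^ t,       2 ^ t + 2 * (-1) ^ t] ∧
      (6 : ℤ) • C t =
        !![2 ^ (t + 1) - 3 + (-1) ^ t, 2 ^ (t + 1) - 2 * (-1) ^ t;
           2 ^ t + 3 - (-1) ^ t,       2 ^ t + 2 * (-1) ^ t] := by
  intro t ht
  induction t, ht using Nat.le_induction with
  | base =>
    rw [hB1, hC1, hA0, hA1]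
    decide
  | succ t ht ih =>
    obtain ⟨ihB, ihC⟩ := ih
    rw [hB t ht, hC t ht, smul_add, smul_add, ← mul_smul_comm, ← mul_smul_comm,
      ← mul_smul_comm, ← mul_smul_comm, ihB, ihC, hA0, hA1]
    constructor <;> ext i j <;> fin_cases i <;> fin_cases j <;>
      simp <;> ring
end

section
/- Let A0 = [[1,1],[0,0]] and A1 = [[0,1],[1,0]] as 2×2 integer matrices, and define for t ≥ 1 the matrices B_t, C_t by B_1 = A0, C_1 = A1, B_t = A0·B_{t−1} + A1·C_{t−1}, and C_t = A0·C_{t−1} + A1·B_{t−1}. Then for every t ≥ 1, the vectors x0 = (2^{t+1} − 2·(−1)^t, 2^t − 3 − (−1)^t)ᵀ and x1 = (2^{t+1} − 2·(−1)^t, 2^t + 3 − (−1)^t)ᵀ satisfy B_t·x0 = 2^{t−1}·x0 and C_t·x1 = 2^{t−1}·x1; that is, x0 and x1 are eigenvectors of B_t and C_t respectively, associated with the eigenvalue 2^{t−1}. -/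
open Matrix

/-- Closed form for the solution of the coupled recurrence: the sum `B + C` is a power of
`!![1, 2; 1, 0]`, while the difference `B - C` is constant. -/
theorem six_smul_parity_matrices
    (B C : ℕ → Matrix (Fin 2) (Fin 2) ℤ)
    (hB1 : B 1 = !![1, 1; 0, 0]) (hC1 : C 1 = !![0, 1; 1, 0])
    (hB : ∀ t, 1 ≤ t → B (t + 1) = !![1, 1; 0, 0] * B t + !![0, 1; 1, 0] * C t)
    (hC : ∀ t, 1 ≤ t → C (t + 1) = !![1, 1; 0, 0] * C t + !![0, 1; 1, 0] * B t)
    (t : ℕ) (ht : 1 ≤ t) :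
    (6 : ℤ) • B t = !![2 * 2 ^ t + (-1) ^ t + 3, 2 * 2 ^ t - 2 * (-1) ^ t;
      2 ^ t - (-1) ^ t - 3, 2 ^ t + 2 * (-1) ^ t] ∧
    (6 : ℤ) • C t = !![2 * 2 ^ t + (-1) ^ t - 3, 2 * 2 ^ t - 2 * (-1) ^ t;
      2 ^ t - (-1) ^ t + 3, 2 ^ t + 2 * (-1) ^ t] := by
  induction t, ht using Nat.le_induction with
  | base =>
    rw [hB1, hC1]
    constructor <;> ext i j <;> fin_cases i <;> fin_cases j <;> simp
  | succ t ht ih =>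
    rw [hB t ht, hC t ht, smul_add, smul_add, ← Matrix.mul_smul, ← Matrix.mul_smul,
      ← Matrix.mul_smul, ← Matrix.mul_smul, ih.1, ih.2]
    constructor <;> ext i j <;> fin_cases i <;> fin_cases j <;> simp [pow_succ] <;> ring

/-- The vectors `x0` and `x1` are eigenvectors of the
even/odd adjacency matrices `B_t` and `C_t` of the `t`-th power graph,
associated with the eigenvalue `2^(t-1)`. -/
theorem power_parity_matrices_eigenvectors
    (A0 A1 : Matrix (Fin 2) (Fin 2) ℤ)
    (hA0 : A0 = !![1, 1; 0, 0]) (hA1 : A1 = !![0, 1; 1, 0])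
    (B C : ℕ → Matrix (Fin 2) (Fin 2) ℤ)
    (hB1 : B 1 = A0) (hC1 : C 1 = A1)
    (hB : ∀ t, 1 ≤ t → B (t + 1) = A0 * B t + A1 * C t)
    (hC : ∀ t, 1 ≤ t → C (t + 1) = A0 * C t + A1 * B t) :
    ∀ t, 1 ≤ t →
      B t *ᵥ ![2 ^ (t + 1) - 2 * (-1) ^ t, 2 ^ t - 3 - (-1) ^ t] =
        ((2 : ℤ) ^ (t - 1)) • ![2 ^ (t + 1) - 2 * (-1) ^ t, 2 ^ t - 3 - (-1) ^ t] ∧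
      C t *ᵥ ![2 ^ (t + 1) - 2 * (-1) ^ t, 2 ^ t + 3 - (-1) ^ t] =
        ((2 : ℤ) ^ (t - 1)) • ![2 ^ (t + 1) - 2 * (-1) ^ t, 2 ^ t + 3 - (-1) ^ t] := by
  subst hA0 hA1
  intro t ht
  obtain ⟨hBt, hCt⟩ := six_smul_parity_matrices B C hB1 hC1 hB hC t ht
  obtain ⟨n, rfl⟩ := Nat.exists_eq_add_of_le' ht
  have h6 : (6 : ℤ) ≠ 0 := by norm_num
  constructor <;> apply smul_right_injective _ h6 <;> dsimp only <;>
    rw [← Matrix.smul_mulVec]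
  · rw [hBt]
    ext i
    fin_cases i <;> simp [pow_succ] <;> ring
  · rw [hCt]
    ext i
    fin_cases i <;> simp [pow_succ] <;> ring
end

section
/- Let A0 = [[1,1],[0,0]] and A1 = [[0,1],[1,0]] as 2×2 integer matrices, and define for t ≥ 1 the matrices B_t, C_t by B_1 = A0, C_1 = A1, B_t = A0·B_{t−1} + A1·C_{t−1}, and C_t = A0·C_{t−1} + A1·B_{t−1}. Let t ≥ 1 and let n0, n1 be positive integers. If there exists a nonzero nonnegative integer vector x ∈ ℤ² with B_t·x ≥ n0·x and C_t·x ≥ n1·x componentwise, then n0 ≤ 2^{t−1}, n1 ≤ 2^{t−1}, and n0 + n1 < 2^t. -/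
open Matrix

/-- The columns of `B (t + 1)` and `C (t + 1)` all sum to `2 ^ t`, the two matrices differ only in
their first column, and their second column is nonnegative with positive top entry. -/
lemma parity_power_entries
    {B C : ℕ → Matrix (Fin 2) (Fin 2) ℤ}
    (hB1 : B 1 = !![1, 1; 0, 0]) (hC1 : C 1 = !![0, 1; 1, 0])
    (hB : ∀ t, 1 ≤ t → B (t + 1) = !![1, 1; 0, 0] * B t + !![0, 1; 1, 0] * C t)
    (hC : ∀ t, 1 ≤ t → C (t + 1) = !![1, 1; 0, 0] * C t + !![0, 1; 1, 0] * B t) (t : ℕ) :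
    B (t + 1) 0 0 + B (t + 1) 1 0 = 2 ^ t ∧ C (t + 1) 0 0 + C (t + 1) 1 0 = 2 ^ t ∧
      C (t + 1) 0 1 + C (t + 1) 1 1 = 2 ^ t ∧ B (t + 1) 0 0 = C (t + 1) 0 0 + 1 ∧
      B (t + 1) 0 1 = C (t + 1) 0 1 ∧ B (t + 1) 1 1 = C (t + 1) 1 1 ∧
      0 < C (t + 1) 0 1 ∧ 0 ≤ C (t + 1) 1 1 := by
  induction t with
  | zero => simp [hB1, hC1]
  | succ t ih =>
    rw [hB (t + 1) (by omega), hC (t + 1) (by omega)]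
    simp only [Matrix.add_apply, Matrix.mul_apply, Fin.sum_univ_two, Matrix.of_apply,
      Matrix.cons_val', Matrix.cons_val_zero, Matrix.cons_val_one, Matrix.cons_val_fin_one,
      pow_succ]
    omega

/-- If a nonzero nonnegative integer vector `x` satisfies
`B_t x ≥ n0 x` and `C_t x ≥ n1 x` componentwise, then `n0 ≤ 2^(t-1)`,
`n1 ≤ 2^(t-1)`, and `n0 + n1 < 2^t`. -/
theorem power_parity_no_common_eigenvector_bound
    (A0 A1 : Matrix (Fin 2) (Fin 2) ℤ)
    (hA0 : A0 = !![1, 1; 0, 0]) (hA1 : A1 = !![0, 1; 1, 0])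
    (B C : ℕ → Matrix (Fin 2) (Fin 2) ℤ)
    (hB1 : B 1 = A0) (hC1 : C 1 = A1)
    (hB : ∀ t, 1 ≤ t → B (t + 1) = A0 * B t + A1 * C t)
    (hC : ∀ t, 1 ≤ t → C (t + 1) = A0 * C t + A1 * B t)
    (t : ℕ) (ht : 1 ≤ t) (n0 n1 : ℤ) (hn0 : 0 < n0) (hn1 : 0 < n1)
    (x : Fin 2 → ℤ) (hx0 : ∀ i, 0 ≤ x i) (hxne : x ≠ 0)
    (hBx : ∀ i, n0 * x i ≤ (B t *ᵥ x) i)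
    (hCx : ∀ i, n1 * x i ≤ (C t *ᵥ x) i) :
    n0 ≤ 2 ^ (t - 1) ∧ n1 ≤ 2 ^ (t - 1) ∧ n0 + n1 < 2 ^ t := by
  subst hA0 hA1
  obtain ⟨s, rfl⟩ := Nat.exists_eq_add_of_le' ht
  obtain ⟨hB0, hC0, hC1', h00, h01, h11, hpos, -⟩ := parity_power_entries hB1 hC1 hB hC s
  have hB0x := hBx 0
  have hB1x := hBx 1
  have hC0x := hCx 0
  have hC1x := hCx 1
  simp only [Matrix.mulVec, dotProduct, Fin.sum_univ_two, h01, h11] at hB0x hB1x hC0x hC1x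
  have hx0' := hx0 0
  have hx1' := hx0 1
  have hsum : 0 < x 0 + x 1 := by
    by_contra! h
    refine hxne (funext fun i => ?_)
    fin_cases i <;> simp <;> omega
  rw [Nat.add_sub_cancel, pow_succ]
  generalize (2 : ℤ) ^ s = P at *
  have hn0P : n0 ≤ P := by
    refine le_of_mul_le_mul_right ?_ hsum
    linear_combination hB0x + hB1x + x 0 * hB0 + x 1 * hC1'
  have hn1P : n1 ≤ P := by
    refine le_of_mul_le_mul_right ?_ hsum
    linear_combination hC0x + hC1x + x 0 * hC0 + x 1 * hC1'
  refine ⟨hn0P, hn1P, ?_⟩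
  by_contra! h
  obtain rfl : n0 = P := by omega
  obtain rfl : n1 = n0 := by omega
  have hx0_zero : x 0 = 0 := by
    refine le_antisymm ?_ hx0'
    linear_combination hC0x + hB1x + x 0 * hB0 + x 1 * hC1' - x 0 * h00
  rw [hx0_zero] at hB0x hB1x hC0x hC1x hsum
  have := mul_pos hpos (by omega : 0 < x 1)
  refine lt_irrefl (0 : ℤ) ?_
  linear_combination this + hC1x + x 1 * hC1'
end

section
/- Let A0 = [[1,1],[0,0]] and A1 = [[0,1],[1,0]] as 2×2 integer matrices, and define for t ≥ 1 the matrices B_t, C_t by B_1 = A0, C_1 = A1, B_t = A0·B_{t−1} + A1·C_{t−1}, and C_t = A0·C_{t−1} + A1·B_{t−1}. Then for every t ≥ 1, the vector x = (2,1)ᵀ satisfies B_t·x ≥ (2^{t−1} − 1)·x and C_t·x ≥ (2^{t−1} − 1)·x componentwise. -/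
open Matrix

/-- Closed form for the action of the even and odd matrices on `(2,1)ᵀ`. -/
theorem parity_mulVec_eq
    (B C : ℕ → Matrix (Fin 2) (Fin 2) ℤ)
    (hB1 : B 1 = !![1, 1; 0, 0]) (hC1 : C 1 = !![0, 1; 1, 0])
    (hB : ∀ t, 1 ≤ t → B (t + 1) = !![1, 1; 0, 0] * B t + !![0, 1; 1, 0] * C t)
    (hC : ∀ t, 1 ≤ t → C (t + 1) = !![1, 1; 0, 0] * C t + !![0, 1; 1, 0] * B t) (n : ℕ) :
    B (n + 1) *ᵥ ![2, 1] = ![2 * 2 ^ n + 1, 2 ^ n - 1] ∧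
      C (n + 1) *ᵥ ![2, 1] = ![2 * 2 ^ n - 1, 2 ^ n + 1] := by
  induction n with
  | zero =>
    rw [zero_add, hB1, hC1]
    decide
  | succ n ih =>
    obtain ⟨ihB, ihC⟩ := ih
    rw [hB (n + 1) (by omega), hC (n + 1) (by omega), add_mulVec, add_mulVec,
      ← mulVec_mulVec, ← mulVec_mulVec, ← mulVec_mulVec, ← mulVec_mulVec, ihB, ihC]
    constructor <;> ext i <;> fin_cases i <;> simp [pow_succ] <;> ring

/-- The vector `(2,1)ᵀ` is an
`(B_t, 2^(t-1) - 1)`- and `(C_t, 2^(t-1) - 1)`-approximate eigenvector. -/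
theorem power_parity_approximate_eigenvector
    (A0 A1 : Matrix (Fin 2) (Fin 2) ℤ)
    (hA0 : A0 = !![1, 1; 0, 0]) (hA1 : A1 = !![0, 1; 1, 0])
    (B C : ℕ → Matrix (Fin 2) (Fin 2) ℤ)
    (hB1 : B 1 = A0) (hC1 : C 1 = A1)
    (hB : ∀ t, 1 ≤ t → B (t + 1) = A0 * B t + A1 * C t)
    (hC : ∀ t, 1 ≤ t → C (t + 1) = A0 * C t + A1 * B t) :
    ∀ t, 1 ≤ t →
      (∀ i, ((2 : ℤ) ^ (t - 1) - 1) * (![2, 1] i) ≤ (B t *ᵥ ![2, 1]) i) ∧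
      (∀ i, ((2 : ℤ) ^ (t - 1) - 1) * (![2, 1] i) ≤ (C t *ᵥ ![2, 1]) i) := by
  subst hA0 hA1
  intro t ht
  obtain ⟨n, rfl⟩ := Nat.exists_eq_add_of_le' ht
  obtain ⟨hBn, hCn⟩ := parity_mulVec_eq B C hB1 hC1 hB hC n
  rw [hBn, hCn, Nat.add_sub_cancel]
  constructor <;> intro i <;> fin_cases i <;> simp <;> linarith
end

section
/- Let A0 = [[1,0],[0,0]] and A1 = [[0,2],[1,0]] as 2×2 integer matrices, and define for t ≥ 1 the matrices B_t, C_t by B_1 = A0, C_1 = A1, B_t = A0·B_{t−1} + A1·C_{t−1}, and C_t = A0·C_{t−1} + A1·B_{t−1}. Then for every t ≥ 1: 3·B_t = [[2^{t+1} + (−1)^t, 0], [0, 2^t + 2·(−1)^t]] and 3·C_t = [[0, 2^{t+1} − 2·(−1)^t], [2^t − (−1)^t, 0]]. -/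
open Matrix

/-- Closed form for the even/odd adjacency matrices of the
powers of the two-state graph of Example 4, with the alternative partition
`Σ0 = {a}`, `Σ1 = {b,c,d}`. -/
theorem power_parity_matrices_closed_form_alt
    (A0 A1 : Matrix (Fin 2) (Fin 2) ℤ)
    (hA0 : A0 = !![1, 0; 0, 0]) (hA1 : A1 = !![0, 2; 1, 0])
    (B C : ℕ → Matrix (Fin 2) (Fin 2) ℤ)
    (hB1 : B 1 = A0) (hC1 : C 1 = A1)
    (hB : ∀ t, 1 ≤ t → B (t + 1) = A0 * B t + A1 * C t)
    (hC : ∀ t, 1 ≤ t → C (t + 1) = A0 * C t + A1 * B t) :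
    ∀ t, 1 ≤ t →
      (3 : ℤ) • B t =
        !![2 ^ (t + 1) + (-1) ^ t, 0; 0, 2 ^ t + 2 * (-1) ^ t] ∧
      (3 : ℤ) • C t =
        !![0, 2 ^ (t + 1) - 2 * (-1) ^ t; 2 ^ t - (-1) ^ t, 0] := by
  intro t ht
  induction t, ht using Nat.le_induction with
  | base =>
    subst hA0 hA1
    rw [hB1, hC1]
    constructor <;> ext i j <;> fin_cases i <;> fin_cases j <;> simp
  | succ t ht ih =>
    obtain ⟨ihB, ihC⟩ := ih
    rw [hB t ht, hC t ht, smul_add, smul_add, ← Matrix.mul_smul, ← Matrix.mul_smul,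
      ← Matrix.mul_smul, ← Matrix.mul_smul, ihB, ihC, hA0, hA1]
    constructor <;> ext i j <;> fin_cases i <;> fin_cases j <;> simp <;> ring
end

section
/- Let A0 = [[1,0],[0,0]] and A1 = [[0,2],[1,0]] as 2×2 integer matrices, and define for t ≥ 1 the matrices B_t, C_t by B_1 = A0, C_1 = A1, B_t = A0·B_{t−1} + A1·C_{t−1}, and C_t = A0·C_{t−1} + A1·B_{t−1}. Let t ≥ 1 and let n0, n1 be positive integers. If there exists a nonzero nonnegative integer vector x ∈ ℤ² with B_t·x ≥ n0·x and C_t·x ≥ n1·x componentwise, then 3·n0 ≤ 2^t + 2·(−1)^t and 9·n1² ≤ 2·(2^t − (−1)^t)²; consequently n0 + n1 < 2^t. -/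
open Matrix

/-- Closed form of the parity recursion: the even part is diagonal, the odd part antidiagonal. -/
theorem parity_matrices_closed_form (B C : ℕ → Matrix (Fin 2) (Fin 2) ℤ)
    (hB1 : B 1 = !![1, 0; 0, 0]) (hC1 : C 1 = !![0, 2; 1, 0])
    (hB : ∀ t, 1 ≤ t → B (t + 1) = !![1, 0; 0, 0] * B t + !![0, 2; 1, 0] * C t)
    (hC : ∀ t, 1 ≤ t → C (t + 1) = !![1, 0; 0, 0] * C t + !![0, 2; 1, 0] * B t)
    (t : ℕ) (ht : 1 ≤ t) :
    ∃ s : ℤ, 0 < s ∧ 3 * s = 2 ^ t - (-1) ^ t ∧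
      B t = !![2 * s + (-1) ^ t, 0; 0, s + (-1) ^ t] ∧ C t = !![0, 2 * s; s, 0] := by
  induction t, ht using Nat.le_induction with
  | base => exact ⟨1, by norm_num, by norm_num, by simp [hB1], by simp [hC1]⟩
  | succ t ht ih =>
    obtain ⟨s, hs, h3, hBt, hCt⟩ := ih
    refine ⟨2 * s + (-1) ^ t, ?_, ?_, ?_, ?_⟩
    · rcases neg_one_pow_eq_or ℤ t with h | h <;> rw [h] <;> linarith
    · rw [pow_succ, pow_succ]
      linarith
    · rw [hB t ht, hBt, hCt]
      ext i j
      fin_cases i <;> fin_cases j <;> simp [pow_succ] <;> ring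
    · rw [hC t ht, hBt, hCt]
      ext i j
      fin_cases i <;> fin_cases j <;> simp <;> ring

/-- If a nonzero nonnegative integer vector `x` satisfies
`B_t x ≥ n0 x` and `C_t x ≥ n1 x` componentwise (for the alternative
partition), then `3 n0 ≤ 2^t + 2(-1)^t` and `9 n1² ≤ 2 (2^t - (-1)^t)²`;
consequently `n0 + n1 < 2^t`. -/
theorem power_parity_no_common_eigenvector_bound_alt
    (A0 A1 : Matrix (Fin 2) (Fin 2) ℤ)
    (hA0 : A0 = !![1, 0; 0, 0]) (hA1 : A1 = !![0, 2; 1, 0])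
    (B C : ℕ → Matrix (Fin 2) (Fin 2) ℤ)
    (hB1 : B 1 = A0) (hC1 : C 1 = A1)
    (hB : ∀ t, 1 ≤ t → B (t + 1) = A0 * B t + A1 * C t)
    (hC : ∀ t, 1 ≤ t → C (t + 1) = A0 * C t + A1 * B t)
    (t : ℕ) (ht : 1 ≤ t) (n0 n1 : ℤ) (hn0 : 0 < n0) (hn1 : 0 < n1)
    (x : Fin 2 → ℤ) (hx0 : ∀ i, 0 ≤ x i) (hxne : x ≠ 0)
    (hBx : ∀ i, n0 * x i ≤ (B t *ᵥ x) i)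
    (hCx : ∀ i, n1 * x i ≤ (C t *ᵥ x) i) :
    3 * n0 ≤ 2 ^ t + 2 * (-1) ^ t ∧
    9 * n1 ^ 2 ≤ 2 * (2 ^ t - (-1) ^ t) ^ 2 ∧
    n0 + n1 < 2 ^ t := by
  subst hA0 hA1
  obtain ⟨s, hs, h3, hBt, hCt⟩ := parity_matrices_closed_form B C hB1 hC1 hB hC t ht
  have b1 : n0 * x 1 ≤ (s + (-1) ^ t) * x 1 := by
    simpa [hBt, Matrix.mulVec, dotProduct, Fin.sum_univ_two] using hBx 1
  have c0 : n1 * x 0 ≤ 2 * s * x 1 := by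
    simpa [hCt, Matrix.mulVec, dotProduct, Fin.sum_univ_two] using hCx 0
  have c1 : n1 * x 1 ≤ s * x 0 := by
    simpa [hCt, Matrix.mulVec, dotProduct, Fin.sum_univ_two] using hCx 1
  have x1 : 0 < x 1 := by
    refine (hx0 1).lt_of_ne fun h1 => hxne ?_
    have h0 : x 0 = 0 := by
      rw [← h1] at c0
      nlinarith [hx0 0]
    ext i
    fin_cases i
    · exact h0
    · exact h1.symm
  have hd : n0 ≤ s + (-1) ^ t := le_of_mul_le_mul_right b1 x1
  have hsq : n1 ^ 2 ≤ 2 * s ^ 2 := by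
    refine le_of_mul_le_mul_right ?_ x1
    calc n1 ^ 2 * x 1 = n1 * (n1 * x 1) := by ring
      _ ≤ n1 * (s * x 0) := by gcongr
      _ = s * (n1 * x 0) := by ring
      _ ≤ s * (2 * s * x 1) := by gcongr
      _ = 2 * s ^ 2 * x 1 := by ring
  have hlt : n1 < 2 * s := by nlinarith
  refine ⟨by linarith, ?_, by linarith⟩
  rw [← h3]
  linarith
end

section
/- Let A0 = [[1,0],[0,0]] and A1 = [[0,2],[1,0]] as 2×2 integer matrices, and define for t ≥ 1 the matrices B_t, C_t by B_1 = A0, C_1 = A1, B_t = A0·B_{t−1} + A1·C_{t−1}, and C_t = A0·C_{t−1} + A1·B_{t−1}. Then for every t ≥ 3, setting n^(t) = (2^t + 2·(−1)^t)/3, the vector x = (3,2)ᵀ satisfies B_t·x ≥ n^(t)·x and C_t·x ≥ n^(t)·x componentwise. -/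
open Matrix

/-- Closed form, up to a factor of `3`, for the coordinates of `B t *ᵥ (3,2)ᵀ` and
`C t *ᵥ (3,2)ᵀ`. -/
theorem power_parity_mulVec_closed_form
    (B C : ℕ → Matrix (Fin 2) (Fin 2) ℤ)
    (hB1 : B 1 = !![1, 0; 0, 0]) (hC1 : C 1 = !![0, 2; 1, 0])
    (hB : ∀ t, 1 ≤ t → B (t + 1) = !![1, 0; 0, 0] * B t + !![0, 2; 1, 0] * C t)
    (hC : ∀ t, 1 ≤ t → C (t + 1) = !![1, 0; 0, 0] * C t + !![0, 2; 1, 0] * B t)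
    (t : ℕ) (ht : 1 ≤ t) :
    (B t *ᵥ ![3, 2]) 0 = 2 * 2 ^ t + (-1) ^ t ∧
    3 * (B t *ᵥ ![3, 2]) 1 = 2 * 2 ^ t + 4 * (-1) ^ t ∧
    3 * (C t *ᵥ ![3, 2]) 0 = 4 * 2 ^ t - 4 * (-1) ^ t ∧
    (C t *ᵥ ![3, 2]) 1 = 2 ^ t - (-1) ^ t := by
  induction t, ht using Nat.le_induction with
  | base => simp [hB1, hC1, Matrix.mulVec, dotProduct, Fin.sum_univ_two]
  | succ t ht ih =>
    rw [hB t ht, hC t ht]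
    simp only [Matrix.add_mulVec, ← Matrix.mulVec_mulVec, pow_succ]
    generalize B t *ᵥ ![3, 2] = b at ih ⊢
    generalize C t *ᵥ ![3, 2] = c at ih ⊢
    simp only [Matrix.mulVec, dotProduct, Fin.sum_univ_two, Pi.add_apply, Matrix.of_apply,
      Matrix.cons_val_zero, Matrix.cons_val_one]
    omega

/-- For `t ≥ 3` and `n^(t) = (2^t + 2(-1)^t)/3`, the vector
`(3,2)ᵀ` is an `(B_t, n^(t))`- and `(C_t, n^(t))`-approximate eigenvector
(for the alternative partition). -/
theorem power_parity_approximate_eigenvector_alt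
    (A0 A1 : Matrix (Fin 2) (Fin 2) ℤ)
    (hA0 : A0 = !![1, 0; 0, 0]) (hA1 : A1 = !![0, 2; 1, 0])
    (B C : ℕ → Matrix (Fin 2) (Fin 2) ℤ)
    (hB1 : B 1 = A0) (hC1 : C 1 = A1)
    (hB : ∀ t, 1 ≤ t → B (t + 1) = A0 * B t + A1 * C t)
    (hC : ∀ t, 1 ≤ t → C (t + 1) = A0 * C t + A1 * B t) :
    ∀ t, 3 ≤ t → ∀ n : ℤ, 3 * n = 2 ^ t + 2 * (-1) ^ t →
      (∀ i, n * (![3, 2] i) ≤ (B t *ᵥ ![3, 2]) i) ∧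
      (∀ i, n * (![3, 2] i) ≤ (C t *ᵥ ![3, 2]) i) := by
  subst hA0 hA1
  intro t ht n hn
  obtain ⟨hb0, hb1, hc0, hc1⟩ :=
    power_parity_mulVec_closed_form B C hB1 hC1 hB hC t (by omega)
  have bound : 10 * (-1 : ℤ) ^ t ≤ 2 ^ t ∧ 7 * (-1 : ℤ) ^ t ≤ 2 ^ t ∧ (-1 : ℤ) ^ t ≤ 2 ^ t := by
    obtain rfl | ht4 : t = 3 ∨ 4 ≤ t := by omega
    · norm_num
    · have h16 : (2 : ℤ) ^ 4 ≤ 2 ^ t := pow_le_pow_right₀ (by norm_num) ht4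
      rcases neg_one_pow_eq_or ℤ t with h | h <;> rw [h] <;> omega
  simp only [Fin.forall_fin_two, Matrix.cons_val_zero, Matrix.cons_val_one]
  omega
end
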